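/- Let 𝔠 = Σ_{n=1}^{∞} μ(n)²/(n φ(n)) and Γ₋₁ = ζ(0)( −γ_E − Σ_p (log p)/(p(p−1)) ) − ζ'(0), where μ is the Möbius function, φ is Euler's totient function, ζ is the Riemann zeta function, γ_E is the Euler–Mascheroni constant, and p runs over primes. Then there exist a real constant Γ₀ and κ > 0 such that for all real H ≥ 2: | Σ_{1 ≤ h ≤ H} (H − h)²/φ(h) − ( 𝔠 H² log H + 2Γ₀ H² + H log H + 2Γ₋₁ H ) | ≤ κ H^{1/2}, where h runs over positive integers. -/

import Mathlib

/-- `𝔠 = Σ_{n=1}^∞ μ(n)²/(n φ(n))` (the `n = 0` term vanishes). -/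
noncomputable def frakc : ℝ :=
  ∑' n : ℕ, ((ArithmeticFunction.moebius n : ℝ)) ^ 2 / ((n : ℝ) * (Nat.totient n : ℝ))

/-- `Γ₋₁ = ζ(0)(−γ_E − Σ_p (log p)/(p(p−1))) − ζ'(0)`. -/
noncomputable def GammaMinusOne : ℝ :=
  (riemannZeta 0 * (-(Real.eulerMascheroniConstant : ℂ) -
      ((∑' p : Nat.Primes, Real.log p / ((p : ℝ) * ((p : ℝ) - 1))) : ℝ)) -
    deriv riemannZeta 0).re

section AuxiliaryLemmas

open Finset Filter Topology

/-- If the increments of a convergent sequence are dominated by those of a null sequence, the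
distance to the limit is dominated by that null sequence. -/
lemma abs_sub_le_of_increment_le {a e : ℕ → ℝ} {L : ℝ} (ha : Tendsto a atTop (𝓝 L))
    (he : Tendsto e atTop (𝓝 0)) (h : ∀ n, 1 ≤ n → |a (n + 1) - a n| ≤ e n - e (n + 1))
    {n : ℕ} (hn : 1 ≤ n) : |a n - L| ≤ e n := by
  have key : ∀ m, |a (n + m) - a n| ≤ e n - e (n + m) := by
    intro m
    induction m with
    | zero => simp
    | succ m ih =>
      have h1 := h (n + m) (by omega)
      have h2 := abs_add_le (a (n + m + 1) - a (n + m)) (a (n + m) - a n)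
      rw [sub_add_sub_cancel] at h2
      rw [← add_assoc]
      linarith
  have ha' : Tendsto (fun m => |a (n + m) - a n|) atTop (𝓝 |L - a n|) := by
    have : Tendsto (fun m => a (n + m)) atTop (𝓝 L) := by
      simpa [add_comm] using (tendsto_add_atTop_iff_nat n).2 ha
    exact (this.sub_const _).abs
  have he' : Tendsto (fun m => e n - e (n + m)) atTop (𝓝 (e n - 0)) := by
    have : Tendsto (fun m => e (n + m)) atTop (𝓝 0) := by
      simpa [add_comm] using (tendsto_add_atTop_iff_nat n).2 he
    exact this.const_sub _
  have := le_of_tendsto_of_tendsto' ha' he' key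
  rw [abs_sub_comm]; simpa using this

/-- A function vanishing at `0` with nonnegative derivative on `[0, ∞)` is nonnegative there. -/
lemma nonneg_of_hasDerivAt_nonneg {f f' : ℝ → ℝ} (hf : ∀ t, 0 ≤ t → HasDerivAt f (f' t) t)
    (hf' : ∀ t, 0 ≤ t → 0 ≤ f' t) (h0 : f 0 = 0) {t : ℝ} (ht : 0 ≤ t) : 0 ≤ f t := by
  have hm : MonotoneOn f (Set.Ici 0) := by
    refine monotoneOn_of_hasDerivWithinAt_nonneg (f' := f') (convex_Ici 0)
      (fun x hx => (hf x hx).continuousAt.continuousWithinAt) ?_ ?_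
    · intro x hx
      rw [interior_Ici] at hx
      exact (hf x (le_of_lt hx)).hasDerivWithinAt
    · intro x hx
      rw [interior_Ici] at hx
      exact hf' x (le_of_lt hx)
  rw [← h0]
  exact hm Set.self_mem_Ici ht ht

lemma hasDerivAt_log_one_add {t : ℝ} (ht : 0 ≤ t) :
    HasDerivAt (fun t : ℝ => Real.log (1 + t)) (1 / (1 + t)) t := by
  have := ((hasDerivAt_id t).const_add 1).log (by simp; linarith)
  simpa using this

lemma log_one_add_le_cubic {t : ℝ} (ht : 0 ≤ t) :
    Real.log (1 + t) ≤ t - t ^ 2 / 2 + t ^ 3 / 3 := by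
  have := nonneg_of_hasDerivAt_nonneg
    (f := fun t => t - t ^ 2 / 2 + t ^ 3 / 3 - Real.log (1 + t))
    (f' := fun t => t ^ 3 / (1 + t)) (fun t ht => ?_) (fun t ht => by positivity) (by simp) ht
  · simpa using this
  · have h := ((((hasDerivAt_id t).sub ((hasDerivAt_pow 2 t).div_const 2)).add
      ((hasDerivAt_pow 3 t).div_const 3)).sub (hasDerivAt_log_one_add ht))
    refine h.congr_deriv ?_
    field_simp
    push_cast
    ring

lemma quartic_le_log_one_add {t : ℝ} (ht : 0 ≤ t) :
    t - t ^ 2 / 2 + t ^ 3 / 3 - t ^ 4 / 4 ≤ Real.log (1 + t) := by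
  have := nonneg_of_hasDerivAt_nonneg
    (f := fun t => Real.log (1 + t) - (t - t ^ 2 / 2 + t ^ 3 / 3 - t ^ 4 / 4))
    (f' := fun t => t ^ 4 / (1 + t)) (fun t ht => ?_) (fun t ht => by positivity) (by simp) ht
  · simpa using this
  · have h := (hasDerivAt_log_one_add ht).sub
      ((((hasDerivAt_id t).sub ((hasDerivAt_pow 2 t).div_const 2)).add
      ((hasDerivAt_pow 3 t).div_const 3)).sub ((hasDerivAt_pow 4 t).div_const 4))
    refine h.congr_deriv ?_
    field_simp
    push_cast
    ring

lemma quadratic_le_log_one_add {t : ℝ} (ht : 0 ≤ t) : t - t ^ 2 / 2 ≤ Real.log (1 + t) := by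
  have := nonneg_of_hasDerivAt_nonneg
    (f := fun t => Real.log (1 + t) - (t - t ^ 2 / 2))
    (f' := fun t => t ^ 2 / (1 + t)) (fun t ht => ?_) (fun t ht => by positivity) (by simp) ht
  · simpa using this
  · have h := (hasDerivAt_log_one_add ht).sub
      ((hasDerivAt_id t).sub ((hasDerivAt_pow 2 t).div_const 2))
    refine h.congr_deriv ?_
    field_simp
    push_cast
    ring

lemma log_one_add_le {t : ℝ} (ht : 0 ≤ t) : Real.log (1 + t) ≤ t := by
  have := Real.log_le_sub_one_of_pos (show 0 < 1 + t by linarith)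
  linarith

/-- Partial sums of the harmonic series. -/
noncomputable def harmSum (n : ℕ) : ℝ := ∑ a ∈ Icc 1 n, 1 / (a : ℝ)

/-- Partial sums of `∑ 1 / b ^ 2`. -/
noncomputable def sqSum (n : ℕ) : ℝ := ∑ a ∈ Icc 1 n, 1 / (a : ℝ) ^ 2

/-- Partial sums of `∑ log b / b ^ 2`. -/
noncomputable def logSqSum (n : ℕ) : ℝ := ∑ a ∈ Icc 1 n, Real.log a / (a : ℝ) ^ 2

lemma harmSum_succ (n : ℕ) : harmSum (n + 1) = harmSum n + 1 / ((n : ℝ) + 1) := by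
  simp [harmSum, Finset.sum_Icc_succ_top]

lemma sqSum_succ (n : ℕ) : sqSum (n + 1) = sqSum n + 1 / ((n : ℝ) + 1) ^ 2 := by
  simp [sqSum, Finset.sum_Icc_succ_top]

lemma logSqSum_succ (n : ℕ) :
    logSqSum (n + 1) = logSqSum n + Real.log (n + 1) / ((n : ℝ) + 1) ^ 2 := by
  simp [logSqSum, Finset.sum_Icc_succ_top]

lemma log_succ_eq {n : ℕ} (hn : 1 ≤ n) :
    Real.log ((n : ℝ) + 1) = Real.log n + Real.log (1 + 1 / (n : ℝ)) := by
  have : (0 : ℝ) < n := by exact_mod_cast hn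
  rw [← Real.log_mul (by positivity) (by positivity)]
  congr 1; field_simp

lemma tendsto_const_div_natCast_pow (C : ℝ) {k : ℕ} (hk : k ≠ 0) :
    Tendsto (fun n : ℕ => C / (n : ℝ) ^ k) atTop (𝓝 0) :=
  ((tendsto_pow_atTop hk).comp tendsto_natCast_atTop_atTop).const_div_atTop C

lemma tendsto_harmSum_sub_log :
    Tendsto (fun n : ℕ => harmSum n - Real.log n) atTop (𝓝 Real.eulerMascheroniConstant) := by
  refine Real.tendsto_harmonic_sub_log.congr fun n => ?_
  simp [harmSum, harmonic_eq_sum_Icc]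

lemma harmSum_expansion {n : ℕ} (hn : 1 ≤ n) :
    |harmSum n - (Real.log n + Real.eulerMascheroniConstant + 1 / (2 * n) - 1 / (12 * (n : ℝ) ^ 2))|
      ≤ 1 / (n : ℝ) ^ 3 := by
  have := abs_sub_le_of_increment_le
    (a := fun n => harmSum n - Real.log n - 1 / 2 / (n : ℝ) ^ 1 + 1 / 12 / (n : ℝ) ^ 2)
    (e := fun n => 1 / (n : ℝ) ^ 3)
    (L := Real.eulerMascheroniConstant) ?_ (tendsto_const_div_natCast_pow 1 (by norm_num)) ?_ hn
  · convert this using 2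
    field_simp
    ring
  · simpa using (tendsto_harmSum_sub_log.sub (tendsto_const_div_natCast_pow (1/2) one_ne_zero)).add
      (tendsto_const_div_natCast_pow (1/12) two_ne_zero)
  · intro n hn
    have hl := log_succ_eq hn
    have h1 := log_one_add_le_cubic (t := 1 / (n : ℝ)) (by positivity)
    have h2 := quartic_le_log_one_add (t := 1 / (n : ℝ)) (by positivity)
    push_cast
    rw [harmSum_succ, hl]
    generalize Real.log (1 + 1 / (n : ℝ)) = l at *
    obtain ⟨m, rfl⟩ : ∃ m, n = m + 1 := ⟨n - 1, by omega⟩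
    push_cast at *
    have hm : (0 : ℝ) ≤ m := by positivity
    generalize (m : ℝ) = x at *
    rw [abs_le]
    constructor
    · suffices h : 0 ≤ 1 / (x + 1 + 1) - (1 / (x + 1) - (1 / (x + 1)) ^ 2 / 2
          + (1 / (x + 1)) ^ 3 / 3) - 1 / 2 / (x + 1 + 1) ^ 1 + 1 / 12 / (x + 1 + 1) ^ 2
          + 1 / 2 / (x + 1) ^ 1 - 1 / 12 / (x + 1) ^ 2 + 1 / (x + 1) ^ 3 - 1 / (x + 1 + 1) ^ 3 by
        linarith
      field_simp
      ring_nf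
      positivity
    · suffices h : 0 ≤ 1 / (x + 1) ^ 3 - 1 / (x + 1 + 1) ^ 3 - (1 / (x + 1 + 1) - (1 / (x + 1)
          - (1 / (x + 1)) ^ 2 / 2 + (1 / (x + 1)) ^ 3 / 3 - (1 / (x + 1)) ^ 4 / 4)
          - 1 / 2 / (x + 1 + 1) ^ 1 + 1 / 12 / (x + 1 + 1) ^ 2
          + 1 / 2 / (x + 1) ^ 1 - 1 / 12 / (x + 1) ^ 2) by
        linarith
      field_simp
      ring_nf
      positivity

lemma log_factorial_succ {n : ℕ} :
    Real.log (n + 1).factorial = Real.log (n + 1) + Real.log n.factorial := by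
  rw [Nat.factorial_succ, Nat.cast_mul, Real.log_mul (by positivity) (by positivity)]
  push_cast; rfl

lemma tendsto_log_factorial_sub :
    Tendsto (fun n : ℕ => Real.log n.factorial - (n + 1 / 2) * Real.log n + n) atTop
      (𝓝 (Real.log (2 * Real.pi) / 2)) := by
  have h1 : Tendsto (fun n => Real.log (Stirling.stirlingSeq n) + Real.log 2 / 2) atTop
      (𝓝 (Real.log √Real.pi + Real.log 2 / 2)) :=
    (Stirling.tendsto_stirlingSeq_sqrt_pi.log (by positivity)).add_const _
  have h2 : Real.log √Real.pi + Real.log 2 / 2 = Real.log (2 * Real.pi) / 2 := by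
    rw [Real.log_sqrt Real.pi_pos.le, Real.log_mul (by norm_num) Real.pi_ne_zero]
    ring
  rw [h2] at h1
  refine h1.congr' ?_
  filter_upwards [eventually_ge_atTop 1] with n hn
  have hn' : (0 : ℝ) < n := by exact_mod_cast hn
  rw [Stirling.log_stirlingSeq_formula, Real.log_mul (by norm_num) (by positivity),
    Real.log_div (by positivity) (Real.exp_ne_zero _), Real.log_exp]
  ring

lemma log_factorial_expansion {n : ℕ} (hn : 1 ≤ n) :
    |Real.log n.factorial - (n * Real.log n - n + Real.log n / 2 + Real.log (2 * Real.pi) / 2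
      + 1 / (12 * n))| ≤ 1 / (n : ℝ) ^ 2 := by
  have := abs_sub_le_of_increment_le
    (a := fun n => Real.log n.factorial - (n + 1 / 2) * Real.log n + n - 1 / 12 / (n : ℝ) ^ 1)
    (e := fun n => 1 / (n : ℝ) ^ 2)
    (L := Real.log (2 * Real.pi) / 2) ?_ (tendsto_const_div_natCast_pow 1 (by norm_num)) ?_ hn
  · convert this using 2
    field_simp
    ring
  · simpa using tendsto_log_factorial_sub.sub (tendsto_const_div_natCast_pow (1/12) one_ne_zero)
  · intro n hn
    have hl := log_succ_eq hn
    have h1 := log_one_add_le_cubic (t := 1 / (n : ℝ)) (by positivity)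
    have h2 := quartic_le_log_one_add (t := 1 / (n : ℝ)) (by positivity)
    push_cast
    rw [log_factorial_succ, hl]
    generalize Real.log (1 + 1 / (n : ℝ)) = l at *
    obtain ⟨m, rfl⟩ : ∃ m, n = m + 1 := ⟨n - 1, by omega⟩
    push_cast at *
    have hm : (0 : ℝ) ≤ m := by positivity
    generalize (m : ℝ) = x at *
    have h1' := mul_le_mul_of_nonneg_left h1 (show 0 ≤ x + 1 + 1 / 2 by positivity)
    have h2' := mul_le_mul_of_nonneg_left h2 (show 0 ≤ x + 1 + 1 / 2 by positivity)
    rw [abs_le]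
    constructor
    · suffices h : 0 ≤ 1 - (x + 1 + 1 / 2) * (1 / (x + 1) - (1 / (x + 1)) ^ 2 / 2
          + (1 / (x + 1)) ^ 3 / 3) - 1 / 12 / (x + 1 + 1) ^ 1
          + 1 / 12 / (x + 1) ^ 1 + 1 / (x + 1) ^ 2 - 1 / (x + 1 + 1) ^ 2 by
        linarith
      field_simp
      ring_nf
      positivity
    · suffices h : 0 ≤ 1 / (x + 1) ^ 2 - 1 / (x + 1 + 1) ^ 2 - (1 - (x + 1 + 1 / 2) * (1 / (x + 1)
          - (1 / (x + 1)) ^ 2 / 2 + (1 / (x + 1)) ^ 3 / 3 - (1 / (x + 1)) ^ 4 / 4)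
          - 1 / 12 / (x + 1 + 1) ^ 1 + 1 / 12 / (x + 1) ^ 1) by
        linarith
      field_simp
      ring_nf
      positivity

/-- The value `∑ 1 / b ^ 2 = ζ(2)`. -/
noncomputable def zetaTwo : ℝ := ∑' n : ℕ, 1 / (n : ℝ) ^ 2

/-- The value `∑ log b / b ^ 2 = -ζ'(2)`. -/
noncomputable def logZetaTwo : ℝ := ∑' n : ℕ, Real.log n / (n : ℝ) ^ 2

lemma summable_log_div_sq : Summable fun n : ℕ => Real.log n / (n : ℝ) ^ 2 := by
  have h : Summable fun n : ℕ => 2 * (1 / (n : ℝ) ^ (3 / 2 : ℝ)) :=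
    (Real.summable_one_div_nat_rpow.2 (by norm_num)).mul_left 2
  refine Summable.of_nonneg_of_le (fun n => by positivity) (fun n => ?_) h
  rcases Nat.eq_zero_or_pos n with rfl | hn
  · simp
  have hn' : (0 : ℝ) < n := by exact_mod_cast hn
  have h1 := Real.log_le_rpow_div hn'.le (show (0 : ℝ) < 1 / 2 by norm_num)
  have h2 : (n : ℝ) ^ 2 = (n : ℝ) ^ (1 / 2 : ℝ) * (n : ℝ) ^ (3 / 2 : ℝ) := by
    rw [← Real.rpow_add hn', ← Real.rpow_natCast]
    norm_num
  rw [h2, div_le_iff₀ (by positivity)]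
  refine h1.trans (le_of_eq ?_)
  have : (n : ℝ) ^ (3 / 2 : ℝ) ≠ 0 := by positivity
  field_simp

lemma tendsto_sum_Icc_of_summable {f : ℕ → ℝ} (hf : Summable f) (h0 : f 0 = 0) :
    Tendsto (fun n => ∑ a ∈ Icc 1 n, f a) atTop (𝓝 (∑' n, f n)) := by
  have h := (tendsto_add_atTop_iff_nat 1).2 hf.hasSum.tendsto_sum_nat
  refine h.congr fun n => ?_
  rw [Finset.sum_range_succ', h0, add_zero, Finset.range_eq_Ico, Finset.sum_Ico_add' f 0 n 1]
  rfl

lemma sqSum_expansion {n : ℕ} (hn : 1 ≤ n) :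
    |sqSum n - (zetaTwo - 1 / ((n : ℝ) + 1 / 2))| ≤ 1 / (n : ℝ) ^ 3 := by
  have hz : Tendsto (fun n : ℕ => 1 / ((n : ℝ) + 1 / 2)) atTop (𝓝 0) :=
    (tendsto_atTop_add_const_right _ _ tendsto_natCast_atTop_atTop).const_div_atTop 1
  have := abs_sub_le_of_increment_le
    (a := fun n => sqSum n + 1 / ((n : ℝ) + 1 / 2))
    (e := fun n => 1 / (n : ℝ) ^ 3)
    (L := zetaTwo) ?_ (tendsto_const_div_natCast_pow 1 (by norm_num)) ?_ hn
  · convert this using 2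
    ring
  · have h := tendsto_sum_Icc_of_summable (f := fun n : ℕ => 1 / (n : ℝ) ^ 2)
      (Real.summable_one_div_nat_pow.2 (by norm_num)) (by simp)
    simpa [sqSum, zetaTwo] using h.add hz
  · intro n hn
    rw [sqSum_succ]
    obtain ⟨m, rfl⟩ : ∃ m, n = m + 1 := ⟨n - 1, by omega⟩
    push_cast at *
    have hm : (0 : ℝ) ≤ m := by positivity
    generalize (m : ℝ) = x at *
    rw [abs_le]
    constructor
    · suffices h : 0 ≤ 1 / (x + 1 + 1) ^ 2 + 1 / (x + 1 + 1 + 1 / 2) - 1 / (x + 1 + 1 / 2)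
        + 1 / (x + 1) ^ 3 - 1 / (x + 1 + 1) ^ 3 by linarith
      field_simp
      ring_nf
      positivity
    · suffices h : 0 ≤ 1 / (x + 1) ^ 3 - 1 / (x + 1 + 1) ^ 3 - (1 / (x + 1 + 1) ^ 2
        + 1 / (x + 1 + 1 + 1 / 2) - 1 / (x + 1 + 1 / 2)) by linarith
      field_simp
      ring_nf
      positivity

lemma harmSum_midpoint_expansion {n : ℕ} (hn : 1 ≤ n) :
    |harmSum n - (Real.log (n + 1 / 2) + Real.eulerMascheroniConstant)| ≤ 2 / (n : ℝ) ^ 2 := by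
  have hn' : (0 : ℝ) < n := by exact_mod_cast hn
  have h := harmSum_expansion hn
  have hl : Real.log ((n : ℝ) + 1 / 2) = Real.log n + Real.log (1 + 1 / (2 * n)) := by
    rw [← Real.log_mul (by positivity) (by positivity)]
    congr 1; field_simp
  have h1 := log_one_add_le (t := 1 / (2 * (n : ℝ))) (by positivity)
  have h2 := quadratic_le_log_one_add (t := 1 / (2 * (n : ℝ))) (by positivity)
  have h3 : 1 / (n : ℝ) ^ 3 ≤ 1 / (n : ℝ) ^ 2 := by
    gcongr
    · exact_mod_cast hn
    · norm_num
  have e1 : 1 / (12 * (n : ℝ) ^ 2) = 1 / 12 * (1 / (n : ℝ) ^ 2) := by field_simp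
  have e2 : (1 / (2 * (n : ℝ))) ^ 2 / 2 = 1 / 8 * (1 / (n : ℝ) ^ 2) := by field_simp; norm_num
  have e3 : 2 / (n : ℝ) ^ 2 = 2 * (1 / (n : ℝ) ^ 2) := by field_simp
  have : 0 < 1 / (n : ℝ) ^ 2 := by positivity
  rw [e2] at h2
  rw [e1, abs_le] at h
  rw [hl, e3, abs_le]
  constructor <;> linarith

lemma logSqSum_expansion {n : ℕ} (hn : 1 ≤ n) :
    |logSqSum n - (logZetaTwo - (Real.log (n + 1 / 2) + 1) / ((n : ℝ) + 1 / 2))|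
      ≤ 4 * (1 + Real.log n) / (n : ℝ) ^ 3 := by
  have ht : Tendsto (fun n : ℕ => (n : ℝ) + 1 / 2) atTop atTop :=
    tendsto_atTop_add_const_right _ _ tendsto_natCast_atTop_atTop
  have hz : Tendsto (fun n : ℕ => 1 / ((n : ℝ) + 1 / 2)) atTop (𝓝 0) := ht.const_div_atTop 1
  have hz' : Tendsto (fun n : ℕ => (Real.log (n + 1 / 2) + 1) / ((n : ℝ) + 1 / 2)) atTop (𝓝 0) := by
    have := (Real.isLittleO_log_id_atTop.tendsto_div_nhds_zero.comp ht).add hz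
    simpa [add_div] using this
  have he : Tendsto (fun n : ℕ => 4 * (1 + Real.log n) / (n : ℝ) ^ 3) atTop (𝓝 0) := by
    have h1 := Real.isLittleO_log_id_atTop.tendsto_div_nhds_zero.comp
      (tendsto_natCast_atTop_atTop (R := ℝ))
    have h2 := ((h1.mul (tendsto_const_div_natCast_pow 1 two_ne_zero)).add
      (tendsto_const_div_natCast_pow 1 three_ne_zero)).const_mul 4
    simp only [mul_zero, add_zero] at h2
    refine h2.congr' ?_
    filter_upwards [eventually_ge_atTop 1] with n hn
    have hn' : (0 : ℝ) < n := by exact_mod_cast hn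
    simp only [Function.comp, id]
    field_simp
    ring
  have := abs_sub_le_of_increment_le
    (a := fun n => logSqSum n + (Real.log (n + 1 / 2) + 1) / ((n : ℝ) + 1 / 2))
    (e := fun n => 4 * (1 + Real.log n) / (n : ℝ) ^ 3)
    (L := logZetaTwo) ?_ he ?_ hn
  · convert this using 2
    ring
  · have h := tendsto_sum_Icc_of_summable summable_log_div_sq (by simp)
    simpa [logSqSum, logZetaTwo] using h.add hz'
  · intro n hn
    have hn' : (0 : ℝ) < n := by exact_mod_cast hn
    have hl := log_succ_eq hn
    have hl2 : Real.log ((n : ℝ) + 1 / 2) = Real.log n + Real.log (1 + 1 / (2 * n)) := by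
      rw [← Real.log_mul (by positivity) (by positivity)]
      congr 1; field_simp
    have hl3 : Real.log ((n : ℝ) + 1 + 1 / 2) = Real.log n + Real.log (1 + 3 / (2 * n)) := by
      rw [← Real.log_mul (by positivity) (by positivity)]
      congr 1; field_simp; ring
    have hpos : 0 ≤ Real.log n := Real.log_natCast_nonneg n
    have h1 := log_one_add_le_cubic (t := 1 / (n : ℝ)) (by positivity)
    have h1' := quartic_le_log_one_add (t := 1 / (n : ℝ)) (by positivity)
    have h1'' := log_one_add_le (t := 1 / (n : ℝ)) (by positivity)
    have h2 := log_one_add_le_cubic (t := 1 / (2 * (n : ℝ))) (by positivity)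
    have h2' := quartic_le_log_one_add (t := 1 / (2 * (n : ℝ))) (by positivity)
    have h3 := log_one_add_le_cubic (t := 3 / (2 * (n : ℝ))) (by positivity)
    have h3' := quartic_le_log_one_add (t := 3 / (2 * (n : ℝ))) (by positivity)
    push_cast
    rw [logSqSum_succ, hl, hl2, hl3]
    generalize Real.log (1 + 1 / (n : ℝ)) = l1 at *
    generalize Real.log (1 + 1 / (2 * (n : ℝ))) = l2 at *
    generalize Real.log (1 + 3 / (2 * (n : ℝ))) = l3 at *
    clear hl hl2 hl3 he hz hz' ht
    generalize Real.log (n : ℝ) = l at *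
    obtain ⟨m, rfl⟩ : ∃ m, n = m + 1 := ⟨n - 1, by omega⟩
    push_cast at *
    have hm : (0 : ℝ) ≤ m := by positivity
    generalize (m : ℝ) = x at *
    have b1 := mul_le_mul_of_nonneg_left h1 (show 0 ≤ 1 / (x + 1 + 1) ^ 2 by positivity)
    have b1' := mul_le_mul_of_nonneg_left h1' (show 0 ≤ 1 / (x + 1 + 1) ^ 2 by positivity)
    have b1'' := mul_le_mul_of_nonneg_left h1'' (show 0 ≤ 4 / (x + 1 + 1) ^ 3 by positivity)
    have b2 := mul_le_mul_of_nonneg_left h2 (show 0 ≤ 1 / (x + 1 + 1 / 2) by positivity)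
    have b2' := mul_le_mul_of_nonneg_left h2' (show 0 ≤ 1 / (x + 1 + 1 / 2) by positivity)
    have b3 := mul_le_mul_of_nonneg_left h3 (show 0 ≤ 1 / (x + 1 + 1 + 1 / 2) by positivity)
    have b3' := mul_le_mul_of_nonneg_left h3' (show 0 ≤ 1 / (x + 1 + 1 + 1 / 2) by positivity)
    have c1 : 0 ≤ l * (4 / (x + 1) ^ 3 - 4 / (x + 1 + 1) ^ 3 + (1 / (x + 1 + 1) ^ 2
        + 1 / (x + 1 + 1 + 1 / 2) - 1 / (x + 1 + 1 / 2))) := by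
      refine mul_nonneg hpos ?_
      field_simp
      ring_nf
      positivity
    have c2 : 0 ≤ l * (4 / (x + 1) ^ 3 - 4 / (x + 1 + 1) ^ 3 - (1 / (x + 1 + 1) ^ 2
        + 1 / (x + 1 + 1 + 1 / 2) - 1 / (x + 1 + 1 / 2))) := by
      refine mul_nonneg hpos ?_
      field_simp
      ring_nf
      positivity
    clear h1 h1' h1'' h2 h2' h3 h3'
    rw [abs_le]
    constructor
    · suffices h : 0 ≤ 1 / (x + 1 + 1) ^ 2 * (1 / (x + 1) - (1 / (x + 1)) ^ 2 / 2
          + (1 / (x + 1)) ^ 3 / 3 - (1 / (x + 1)) ^ 4 / 4)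
          + 1 / (x + 1 + 1 + 1 / 2) * (1 + (3 / (2 * (x + 1)) - (3 / (2 * (x + 1))) ^ 2 / 2
          + (3 / (2 * (x + 1))) ^ 3 / 3 - (3 / (2 * (x + 1))) ^ 4 / 4))
          - 1 / (x + 1 + 1 / 2) * (1 + (1 / (2 * (x + 1)) - (1 / (2 * (x + 1))) ^ 2 / 2
          + (1 / (2 * (x + 1))) ^ 3 / 3))
          + 4 / (x + 1) ^ 3 - 4 / (x + 1 + 1) ^ 3 - 4 / (x + 1 + 1) ^ 3 * (1 / (x + 1)) by
        linear_combination h + b1' + b3' + b2 + b1'' + c1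
      field_simp
      ring_nf
      positivity
    · suffices h : 0 ≤ 4 / (x + 1) ^ 3 - 4 / (x + 1 + 1) ^ 3 - 4 / (x + 1 + 1) ^ 3 * (1 / (x + 1))
          - (1 / (x + 1 + 1) ^ 2 * (1 / (x + 1) - (1 / (x + 1)) ^ 2 / 2 + (1 / (x + 1)) ^ 3 / 3)
          + 1 / (x + 1 + 1 + 1 / 2) * (1 + (3 / (2 * (x + 1)) - (3 / (2 * (x + 1))) ^ 2 / 2
          + (3 / (2 * (x + 1))) ^ 3 / 3))
          - 1 / (x + 1 + 1 / 2) * (1 + (1 / (2 * (x + 1)) - (1 / (2 * (x + 1))) ^ 2 / 2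
          + (1 / (2 * (x + 1))) ^ 3 / 3 - (1 / (2 * (x + 1))) ^ 4 / 4))) by
        linear_combination h + b1 + b3 + b2' + b1'' + c2
      field_simp
      ring_nf
      positivity

lemma sum_Icc_natCast (n : ℕ) : ∑ a ∈ Icc 1 n, (a : ℝ) = n * (n + 1) / 2 := by
  induction n with
  | zero => simp
  | succ n ih => rw [Finset.sum_Icc_succ_top (by omega), ih]; push_cast; ring

lemma sum_sub_sq_div (y : ℝ) (n : ℕ) :
    ∑ a ∈ Icc 1 n, (y - a) ^ 2 / (a : ℝ) = y ^ 2 * harmSum n - 2 * y * n + n * (n + 1) / 2 := by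
  have h : ∀ a ∈ Icc 1 n, (y - a) ^ 2 / (a : ℝ) = y ^ 2 * (1 / (a : ℝ)) - 2 * y + a := by
    intro a ha
    have : (a : ℝ) ≠ 0 := by have := (mem_Icc.1 ha).1; positivity
    field_simp; ring
  rw [sum_congr rfl h, sum_add_distrib, sum_sub_distrib, ← mul_sum, sum_Icc_natCast, harmSum]
  simp; ring

lemma sum_div_sub_one_sq (z : ℝ) (n : ℕ) :
    ∑ b ∈ Icc 1 n, (z / b - 1) ^ 2 = z ^ 2 * sqSum n - 2 * z * harmSum n + n := by
  have h : ∀ b ∈ Icc 1 n, (z / (b : ℝ) - 1) ^ 2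
      = z ^ 2 * (1 / (b : ℝ) ^ 2) - 2 * z * (1 / (b : ℝ)) + 1 := by
    intro a ha
    have : (a : ℝ) ≠ 0 := by have := (mem_Icc.1 ha).1; positivity
    field_simp; ring
  rw [sum_congr rfl h, sum_add_distrib, sum_sub_distrib, ← mul_sum, ← mul_sum, harmSum, sqSum]
  simp

/-- Decomposition of a real number `y ≥ 1` together with the expansion of its logarithm around
its integer part. -/
lemma exists_floor_log_expansion {y : ℝ} (hy : 1 ≤ y) :
    ∃ n : ℕ, ⌊y⌋₊ = n ∧ 1 ≤ n ∧ ∃ θ l : ℝ, y = n + θ ∧ 0 ≤ θ ∧ θ ≤ 1 ∧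
      Real.log y = Real.log n + l ∧ |l - (θ / n - θ ^ 2 / (2 * n ^ 2))| ≤ 1 / (n : ℝ) ^ 3 ∧
      1 / (n : ℝ) ≤ 2 / y := by
  have hn : 1 ≤ ⌊y⌋₊ := Nat.le_floor (by simpa using hy)
  have hn' : (1 : ℝ) ≤ ⌊y⌋₊ := by exact_mod_cast hn
  have h1 := Nat.floor_le (show 0 ≤ y by linarith)
  have h2 := Nat.lt_floor_add_one y
  refine ⟨⌊y⌋₊, rfl, hn, y - ⌊y⌋₊, Real.log (1 + (y - ⌊y⌋₊) / ⌊y⌋₊), by ring, by linarith,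
    by linarith, ?_, ?_, ?_⟩
  · have h0 : 0 ≤ (y - ⌊y⌋₊) / ⌊y⌋₊ := div_nonneg (by linarith) (by positivity)
    rw [← Real.log_mul (by positivity) (by positivity)]
    congr 1; field_simp; ring
  · generalize (⌊y⌋₊ : ℝ) = n at *
    obtain ⟨θ, hθ⟩ : ∃ θ, θ = y - n := ⟨_, rfl⟩
    rw [← hθ]
    have h0 : 0 ≤ θ := by linarith
    have h1' : θ ≤ 1 := by linarith
    have hp := quadratic_le_log_one_add (t := θ / n) (by positivity)
    have hq := log_one_add_le_cubic (t := θ / n) (by positivity)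
    have e1 : (θ / n) ^ 2 / 2 = θ ^ 2 / (2 * n ^ 2) := by field_simp
    have e2 : (θ / n) ^ 3 / 3 ≤ 1 / n ^ 3 := by
      rw [div_pow, div_div, div_le_div_iff₀ (by positivity) (by positivity)]
      have : θ ^ 3 ≤ 1 := pow_le_one₀ h0 h1'
      nlinarith [pow_pos (show 0 < n by linarith) 3]
    have : 0 ≤ 1 / n ^ 3 := by positivity
    rw [abs_le]
    constructor <;> linarith
  · rw [div_le_div_iff₀ (by positivity) (by linarith)]
    linarith

lemma abs_sq_mul_le {n θ ε : ℝ} (hn : 1 ≤ n) (h0 : 0 ≤ θ) (h1 : θ ≤ 1) (hε : |ε| ≤ 1 / n ^ 3) :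
    |(n + θ) ^ 2 * ε| ≤ 4 * (1 / n) := by
  rw [abs_mul, abs_of_nonneg (by positivity)]
  calc (n + θ) ^ 2 * |ε| ≤ (2 * n) ^ 2 * (1 / n ^ 3) := by gcongr; linarith
    _ = 4 * (1 / n) := by field_simp; norm_num

lemma abs_mul_le {n θ ε : ℝ} (hn : 1 ≤ n) (h0 : 0 ≤ θ) (h1 : θ ≤ 1) (hε : |ε| ≤ 1 / n ^ 2) :
    |(n + θ) * ε| ≤ 2 * (1 / n) := by
  rw [abs_mul, abs_of_nonneg (by positivity)]
  calc (n + θ) * |ε| ≤ (2 * n) * (1 / n ^ 2) := by gcongr; linarith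
    _ = 2 * (1 / n) := by field_simp

lemma harmonic_weighted_expansion {y : ℝ} (hy : 1 ≤ y) :
    |∑ a ∈ Icc 1 ⌊y⌋₊, (y - a) ^ 2 / (a : ℝ) - (y ^ 2 * Real.log y
      + (Real.eulerMascheroniConstant - 3 / 2) * y ^ 2 + y - 1 / 12)| ≤ 24 / y := by
  obtain ⟨n, hfl, hn, θ, l, hyn, h0, h1, hlog, hl, hny⟩ := exists_floor_log_expansion hy
  have hH := harmSum_expansion hn
  rw [hfl, sum_sub_sq_div, hlog]
  have hn' : (1 : ℝ) ≤ n := by exact_mod_cast hn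
  generalize harmSum n = Hn at *
  generalize Real.log n = L at *
  generalize Real.eulerMascheroniConstant = g at *
  generalize (n : ℝ) = n at *
  obtain ⟨ε, hε⟩ : ∃ ε, ε = Hn - (L + g + 1 / (2 * n) - 1 / (12 * n ^ 2)) := ⟨_, rfl⟩
  obtain ⟨δ, hδ⟩ : ∃ δ, δ = l - (θ / n - θ ^ 2 / (2 * n ^ 2)) := ⟨_, rfl⟩
  rw [← hε] at hH
  rw [← hδ] at hl
  have b1 := abs_le.1 (abs_sq_mul_le hn' h0 h1 hH)
  have b2 := abs_le.1 (abs_sq_mul_le hn' h0 h1 hl)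
  obtain ⟨r, hr⟩ : ∃ r, r = 1 / n := ⟨_, rfl⟩
  have hr0 : 0 ≤ r := by rw [hr]; positivity
  have hr1 : r ≤ 1 := by rw [hr, div_le_one (by linarith)]; exact hn'
  have hrat : y ^ 2 * Hn - 2 * y * n + n * (n + 1) / 2 - (y ^ 2 * (L + l) + (g - 3 / 2) * y ^ 2
      + y - 1 / 12) = (n + θ) ^ 2 * ε - (n + θ) ^ 2 * δ
      + (θ ^ 2 / 2 - θ / 6 - θ ^ 2 / 12 * r + θ ^ 4 / 2 * r) * r := by
    rw [hε, hδ, hyn, hr]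
    field_simp
    ring
  have b3 : |(θ ^ 2 / 2 - θ / 6 - θ ^ 2 / 12 * r + θ ^ 4 / 2 * r)| ≤ 2 := by
    have t2 : θ ^ 2 ≤ 1 := pow_le_one₀ h0 h1
    have t4 : θ ^ 4 ≤ 1 := pow_le_one₀ h0 h1
    have u2 : θ ^ 2 * r ≤ 1 := mul_le_one₀ t2 hr0 hr1
    have u4 : θ ^ 4 * r ≤ 1 := mul_le_one₀ t4 hr0 hr1
    have v2 : 0 ≤ θ ^ 2 * r := by positivity
    have v4 : 0 ≤ θ ^ 4 * r := by positivity
    have w2 : 0 ≤ θ ^ 2 := by positivity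
    rw [abs_le]
    constructor <;> linarith
  have b4 : |(θ ^ 2 / 2 - θ / 6 - θ ^ 2 / 12 * r + θ ^ 4 / 2 * r) * r| ≤ 2 * r := by
    rw [abs_mul, abs_of_nonneg hr0]; gcongr
  have b4 := abs_le.1 b4
  have e : 24 / y = 12 * (2 / y) := by ring
  rw [hrat, abs_le, e]
  rw [← hr] at b1 b2 hny
  constructor <;> linarith [b1.1, b1.2, b2.1, b2.2, b4.1, b4.2]

lemma square_weighted_expansion {z : ℝ} (hz : 1 ≤ z) :
    |∑ b ∈ Icc 1 ⌊z⌋₊, (z / b - 1) ^ 2 - (zetaTwo * z ^ 2 - 2 * z * Real.log z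
      - 2 * Real.eulerMascheroniConstant * z - 1 / 2)| ≤ 40 / z := by
  obtain ⟨n, hfl, hn, θ, l, hyn, h0, h1, hlog, hl, hny⟩ := exists_floor_log_expansion hz
  have hH := harmSum_expansion hn
  have hS := sqSum_expansion hn
  rw [hfl, sum_div_sub_one_sq, hlog]
  have hn' : (1 : ℝ) ≤ n := by exact_mod_cast hn
  have hcube : 1 / (n : ℝ) ^ 3 ≤ 1 / (n : ℝ) ^ 2 := by
    gcongr
    norm_num
  generalize harmSum n = Hn at *
  generalize sqSum n = Sn at *
  generalize zetaTwo = Z at *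
  generalize Real.log n = L at *
  generalize Real.eulerMascheroniConstant = g at *
  generalize (n : ℝ) = n at *
  obtain ⟨ε, hε⟩ : ∃ ε, ε = Hn - (L + g + 1 / (2 * n) - 1 / (12 * n ^ 2)) := ⟨_, rfl⟩
  obtain ⟨η, hη⟩ : ∃ η, η = Sn - (Z - 1 / (n + 1 / 2)) := ⟨_, rfl⟩
  obtain ⟨δ, hδ⟩ : ∃ δ, δ = l - (θ / n - θ ^ 2 / (2 * n ^ 2)) := ⟨_, rfl⟩
  rw [← hε] at hH
  rw [← hδ] at hl
  rw [← hη] at hS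
  have b1 := abs_le.1 (abs_mul_le hn' h0 h1 (hH.trans hcube))
  have b2 := abs_le.1 (abs_mul_le hn' h0 h1 (hl.trans hcube))
  have b5 := abs_le.1 (abs_sq_mul_le hn' h0 h1 hS)
  obtain ⟨r, hr⟩ : ∃ r, r = 1 / n := ⟨_, rfl⟩
  obtain ⟨s, hs⟩ : ∃ s, s = 1 / (n + 1 / 2) := ⟨_, rfl⟩
  have hr0 : 0 ≤ r := by rw [hr]; positivity
  have hr1 : r ≤ 1 := by rw [hr, div_le_one (by linarith)]; exact hn'
  have hs0 : 0 ≤ s := by rw [hs]; positivity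
  have hsr : s ≤ r := by rw [hs, hr]; gcongr; linarith
  have hrat : z ^ 2 * Sn - 2 * z * Hn + n - (Z * z ^ 2 - 2 * z * (L + l) - 2 * g * z - 1 / 2)
      = (n + θ) ^ 2 * η - 2 * ((n + θ) * ε) + 2 * ((n + θ) * δ) - (θ - 1 / 2) ^ 2 * s
      + (-θ + 1 / 6 + θ / 6 * r + θ ^ 2 - θ ^ 3 * r) * r := by
    rw [hε, hδ, hyn, hr, hη, hs]
    field_simp
    ring
  have t2 : θ ^ 2 ≤ 1 := pow_le_one₀ h0 h1
  have w2 : 0 ≤ θ ^ 2 := by positivity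
  have b3 : |(-θ + 1 / 6 + θ / 6 * r + θ ^ 2 - θ ^ 3 * r)| ≤ 4 := by
    have t4 : θ ^ 3 ≤ 1 := pow_le_one₀ h0 h1
    have u2 : θ * r ≤ 1 := mul_le_one₀ h1 hr0 hr1
    have u4 : θ ^ 3 * r ≤ 1 := mul_le_one₀ t4 hr0 hr1
    have v2 : 0 ≤ θ * r := by positivity
    have v4 : 0 ≤ θ ^ 3 * r := by positivity
    rw [abs_le]
    constructor <;> linarith
  have b4 : |(-θ + 1 / 6 + θ / 6 * r + θ ^ 2 - θ ^ 3 * r) * r| ≤ 4 * r := by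
    rw [abs_mul, abs_of_nonneg hr0]; gcongr
  have b4 := abs_le.1 b4
  have b6 : (θ - 1 / 2) ^ 2 * s ≤ 1 * r := by
    gcongr
    nlinarith
  have b7 : 0 ≤ (θ - 1 / 2) ^ 2 * s := by positivity
  have e : 40 / z = 20 * (2 / z) := by ring
  rw [hrat, abs_le, e]
  rw [← hr] at b1 b2 b5 hny
  constructor <;> linarith [b1.1, b1.2, b2.1, b2.2, b4.1, b4.2, b5.1, b5.2]

lemma log_two_pi_le : Real.log (2 * Real.pi) ≤ 2 := by
  rw [Real.log_le_iff_le_exp (by positivity)]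
  have h1 := Real.exp_one_gt_d9
  have h2 := Real.pi_lt_d2
  have : Real.exp 2 = Real.exp 1 * Real.exp 1 := by rw [← Real.exp_add]; norm_num
  nlinarith

lemma log_weighted_expansion {y : ℝ} (hy : 1 / 2 ≤ y) :
    |y ^ 2 * harmSum ⌊y⌋₊ - 2 * y * ⌊y⌋₊ * Real.log y + 2 * y * Real.log (⌊y⌋₊).factorial
      - ⌊y⌋₊ * (⌊y⌋₊ + 1) / 2 - (y ^ 2 * Real.log y
      + (Real.eulerMascheroniConstant - 5 / 2) * y ^ 2 + y * Real.log y
      + y * Real.log (2 * Real.pi) + 1 / 12)| ≤ 70 / y := by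
  rcases lt_or_ge y 1 with hy1 | hy1
  · have hfl : ⌊y⌋₊ = 0 := Nat.floor_eq_zero.2 hy1
    have hL1 : Real.log y ≤ 0 := Real.log_nonpos (by linarith) hy1.le
    have hL2 : -1 ≤ Real.log y := by
      have := Real.one_sub_inv_le_log_of_pos (show 0 < y by linarith)
      have h2 : y⁻¹ ≤ 2 := by
        rw [inv_le_comm₀ (by linarith) (by norm_num)]
        linarith
      linarith
    have hg1 := Real.one_half_lt_eulerMascheroniConstant
    have hg2 := Real.eulerMascheroniConstant_lt_two_thirds
    have hp := log_two_pi_le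
    have hp0 : 0 ≤ Real.log (2 * Real.pi) := Real.log_nonneg (by linarith [Real.pi_gt_three])
    have h70 : 70 ≤ 70 / y := by rw [le_div_iff₀ (by linarith)]; linarith
    rw [hfl]
    simp only [harmSum, Nat.factorial_zero, Nat.cast_one, Real.log_one, Nat.cast_zero]
    simp only [Nat.lt_one_iff, Icc_eq_empty_of_lt, sum_empty]
    generalize Real.log y = L at *
    generalize Real.log (2 * Real.pi) = P at *
    generalize Real.eulerMascheroniConstant = g at *
    refine le_trans ?_ h70
    have hy2 : y ^ 2 ≤ 1 := by nlinarith
    have hy3 : 0 ≤ y ^ 2 := by positivity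
    rw [abs_le]
    constructor
    · nlinarith
    · nlinarith
  obtain ⟨n, hfl, hn, θ, l, hyn, h0, h1, hlog, hl, hny⟩ := exists_floor_log_expansion hy1
  have hH := harmSum_expansion hn
  have hF := log_factorial_expansion hn
  rw [hfl, hlog]
  have hn' : (1 : ℝ) ≤ n := by exact_mod_cast hn
  generalize harmSum n = Hn at *
  generalize Real.log n.factorial = F at *
  generalize Real.log n = L at *
  generalize Real.log (2 * Real.pi) = P at *
  generalize Real.eulerMascheroniConstant = g at *
  generalize (n : ℝ) = n at *
  obtain ⟨ε, hε⟩ : ∃ ε, ε = Hn - (L + g + 1 / (2 * n) - 1 / (12 * n ^ 2)) := ⟨_, rfl⟩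
  obtain ⟨η, hη⟩ : ∃ η, η = F - (n * L - n + L / 2 + P / 2 + 1 / (12 * n)) := ⟨_, rfl⟩
  obtain ⟨δ, hδ⟩ : ∃ δ, δ = l - (θ / n - θ ^ 2 / (2 * n ^ 2)) := ⟨_, rfl⟩
  rw [← hε] at hH
  rw [← hδ] at hl
  rw [← hη] at hF
  have b1 := abs_le.1 (abs_sq_mul_le hn' h0 h1 hH)
  have b2 : |(2 * y * n + y ^ 2 + y) * δ| ≤ 10 * (1 / n) := by
    have hyn' : y ≤ 2 * n := by linarith
    rw [abs_mul, abs_of_nonneg (by positivity)]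
    calc (2 * y * n + y ^ 2 + y) * |δ|
        ≤ (2 * (2 * n) * n + (2 * n) ^ 2 + (2 * n) * n) * (1 / n ^ 3) := by
          gcongr
          nlinarith
      _ = 10 * (1 / n) := by field_simp; norm_num
  have b2 := abs_le.1 b2
  have b5 := abs_le.1 (abs_mul_le hn' h0 h1 hF)
  obtain ⟨r, hr⟩ : ∃ r, r = 1 / n := ⟨_, rfl⟩
  have hr0 : 0 ≤ r := by rw [hr]; positivity
  have hr1 : r ≤ 1 := by rw [hr, div_le_one (by linarith)]; exact hn'
  have hrat : y ^ 2 * Hn - 2 * y * n * (L + l) + 2 * y * F - n * (n + 1) / 2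
      - (y ^ 2 * (L + l) + (g - 5 / 2) * y ^ 2 + y * (L + l) + y * P + 1 / 12)
      = (n + θ) ^ 2 * ε + 2 * ((n + θ) * η) - (2 * y * n + y ^ 2 + y) * δ
      + (θ ^ 3 - θ ^ 2 / 12 * r + θ ^ 4 / 2 * r + θ ^ 3 / 2 * r) * r := by
    rw [hε, hδ, hyn, hr, hη]
    field_simp
    ring
  have b3 : |(θ ^ 3 - θ ^ 2 / 12 * r + θ ^ 4 / 2 * r + θ ^ 3 / 2 * r)| ≤ 4 := by
    have t2 : θ ^ 2 ≤ 1 := pow_le_one₀ h0 h1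
    have t3 : θ ^ 3 ≤ 1 := pow_le_one₀ h0 h1
    have t4 : θ ^ 4 ≤ 1 := pow_le_one₀ h0 h1
    have u2 : θ ^ 2 * r ≤ 1 := mul_le_one₀ t2 hr0 hr1
    have u3 : θ ^ 3 * r ≤ 1 := mul_le_one₀ t3 hr0 hr1
    have u4 : θ ^ 4 * r ≤ 1 := mul_le_one₀ t4 hr0 hr1
    have v2 : 0 ≤ θ ^ 2 * r := by positivity
    have v3 : 0 ≤ θ ^ 3 * r := by positivity
    have v4 : 0 ≤ θ ^ 4 * r := by positivity
    have w3 : 0 ≤ θ ^ 3 := by positivity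
    rw [abs_le]
    constructor <;> linarith
  have b4 : |(θ ^ 3 - θ ^ 2 / 12 * r + θ ^ 4 / 2 * r + θ ^ 3 / 2 * r) * r| ≤ 4 * r := by
    rw [abs_mul, abs_of_nonneg hr0]; gcongr
  have b4 := abs_le.1 b4
  have e : 70 / y = 35 * (2 / y) := by ring
  rw [hrat, abs_le, e]
  rw [← hr] at b1 b2 b5 hny
  constructor <;> linarith [b1.1, b1.2, b2.1, b2.2, b4.1, b4.2, b5.1, b5.2]

/-- The Riesz-type mean `∑_{a ≤ y} (y - a)² / a`. -/
noncomputable def harmonicMean (y : ℝ) : ℝ := ∑ a ∈ Icc 1 ⌊y⌋₊, (y - a) ^ 2 / (a : ℝ)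

/-- The Riesz-type mean of `∑_{b ∣ n} 1 / b` obtained by summing `harmonicMean (x / b)`. -/
noncomputable def divisorMean (x : ℝ) : ℝ := ∑ b ∈ Icc 1 ⌊x⌋₊, harmonicMean (x / b)

lemma sum_Icc_filter_mul_le (X N : ℕ) (f : ℕ → ℕ → ℝ) :
    ∑ b ∈ Icc 1 N, ∑ a ∈ Icc 1 X, (if a * b ≤ X then f a b else 0)
      = ∑ b ∈ Icc 1 N, ∑ a ∈ Icc 1 (X / b), f a b := by
  refine sum_congr rfl fun b hb => ?_
  have hb1 := (mem_Icc.1 hb).1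
  rw [← sum_filter]
  refine sum_congr ?_ fun _ _ => rfl
  ext a
  simp only [mem_filter, mem_Icc, Nat.le_div_iff_mul_le hb1]
  constructor
  · rintro ⟨⟨h1, h2⟩, h3⟩; exact ⟨h1, h3⟩
  · rintro ⟨h1, h3⟩; exact ⟨⟨h1, (Nat.le_mul_of_pos_right a hb1).trans h3⟩, h3⟩

lemma sum_Icc_ite_le {X N : ℕ} (hN : N ≤ X) (f : ℕ → ℝ) :
    ∑ b ∈ Icc 1 X, (if b ≤ N then f b else 0) = ∑ b ∈ Icc 1 N, f b := by
  rw [← sum_filter]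
  refine sum_congr ?_ fun _ _ => rfl
  ext a
  simp only [mem_filter, mem_Icc]
  omega

/-- The hyperbola method. -/
lemma hyperbola_sum {X N A : ℕ} (hN : N ≤ X) (hA : A ≤ X) (h1 : N * A ≤ X)
    (h2 : X < (N + 1) * (A + 1)) (f : ℕ → ℕ → ℝ) :
    ∑ b ∈ Icc 1 X, ∑ a ∈ Icc 1 (X / b), f a b
      = ∑ b ∈ Icc 1 N, ∑ a ∈ Icc 1 (X / b), f a b + ∑ a ∈ Icc 1 A, ∑ b ∈ Icc 1 (X / a), f a b
        - ∑ b ∈ Icc 1 N, ∑ a ∈ Icc 1 A, f a b := by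
  have e1 := sum_Icc_filter_mul_le X X f
  have e2 := sum_Icc_filter_mul_le X N f
  have e3 := sum_Icc_filter_mul_le X A (fun b a => f a b)
  rw [← e1, ← e2, ← e3, ← sum_Icc_ite_le hN, ← sum_Icc_ite_le hA, ← sum_Icc_ite_le hN]
  have hinner : ∀ b, ∑ a ∈ Icc 1 A, f a b = ∑ a ∈ Icc 1 X, if a ≤ A then f a b else 0 :=
    fun b => (sum_Icc_ite_le hA (fun a => f a b)).symm
  have hswap : ∑ a ∈ Icc 1 X, (if a ≤ A then ∑ b ∈ Icc 1 X, (if b * a ≤ X then f a b else 0) else 0)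
      = ∑ b ∈ Icc 1 X, ∑ a ∈ Icc 1 X, if a ≤ A then (if b * a ≤ X then f a b else 0) else 0 := by
    rw [sum_comm]
    refine sum_congr rfl fun a _ => ?_
    split_ifs <;> simp
  rw [hswap, ← sum_add_distrib, ← sum_sub_distrib]
  refine sum_congr rfl fun b hb => ?_
  rw [hinner]
  by_cases hb : b ≤ N
  · simp only [hb, if_true]
    rw [← sum_add_distrib, ← sum_sub_distrib]
    refine sum_congr rfl fun a ha => ?_
    by_cases ha : a ≤ A
    · have : a * b ≤ X := (Nat.mul_le_mul ha hb).trans (by rwa [mul_comm])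
      simp [ha, this, mul_comm b a]
    · simp [ha]
  · simp only [hb, if_false, zero_add, sub_zero]
    refine sum_congr rfl fun a ha => ?_
    by_cases ha : a ≤ A
    · simp [ha, mul_comm b a]
    · have : ¬ a * b ≤ X := by
        have : (N + 1) * (A + 1) ≤ b * a := Nat.mul_le_mul (by omega) (by omega)
        rw [mul_comm a b]; omega
      simp [ha, this]

lemma box_sum (x : ℝ) (N A : ℕ) :
    ∑ b ∈ Icc 1 N, ∑ a ∈ Icc 1 A, (x / b - a) ^ 2 / (a : ℝ)
      = x ^ 2 * harmSum A * sqSum N - 2 * x * A * harmSum N + N * (A * (A + 1) / 2) := by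
  have h : ∀ b ∈ Icc 1 N, ∑ a ∈ Icc 1 A, (x / b - a) ^ 2 / (a : ℝ)
      = x ^ 2 * harmSum A * (1 / (b : ℝ) ^ 2) - 2 * x * A * (1 / (b : ℝ)) + A * (A + 1) / 2 := by
    intro b hb
    rw [sum_sub_sq_div]
    have : (b : ℝ) ≠ 0 := by have := (mem_Icc.1 hb).1; positivity
    field_simp
  rw [sum_congr rfl h, sum_add_distrib, sum_sub_distrib, ← mul_sum, ← mul_sum, harmSum, sqSum]
  simp [harmSum]

lemma divisorMean_hyperbola {x : ℝ} (hx : 0 ≤ x) {N A : ℕ} (hN : N ≤ ⌊x⌋₊) (hA : A ≤ ⌊x⌋₊)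
    (h1 : (N * A : ℝ) ≤ x) (h2 : x < (N + 1) * (A + 1)) :
    divisorMean x = ∑ b ∈ Icc 1 N, harmonicMean (x / b)
      + ∑ a ∈ Icc 1 A, (a : ℝ) * ∑ b ∈ Icc 1 ⌊x / a⌋₊, (x / a / b - 1) ^ 2
      - (x ^ 2 * harmSum A * sqSum N - 2 * x * A * harmSum N + N * (A * (A + 1) / 2)) := by
  have h1' : N * A ≤ ⌊x⌋₊ := Nat.le_floor (by exact_mod_cast h1)
  have h2' : ⌊x⌋₊ < (N + 1) * (A + 1) := (Nat.floor_lt hx).2 (by exact_mod_cast h2)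
  have key := hyperbola_sum hN hA h1' h2' (fun a b => (x / b - a) ^ 2 / (a : ℝ))
  rw [box_sum] at key
  simp only [divisorMean, harmonicMean, Nat.floor_div_natCast]
  rw [key]
  congr 2
  refine sum_congr rfl fun a ha => ?_
  rw [mul_sum]
  refine sum_congr rfl fun b hb => ?_
  have ha : (a : ℝ) ≠ 0 := by have := (mem_Icc.1 ha).1; positivity
  have hb : (b : ℝ) ≠ 0 := by have := (mem_Icc.1 hb).1; positivity
  field_simp

lemma sum_log_Icc (n : ℕ) : ∑ a ∈ Icc 1 n, Real.log a = Real.log n.factorial := by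
  induction n with
  | zero => simp
  | succ n ih =>
    rw [Finset.sum_Icc_succ_top (by omega), ih, Nat.factorial_succ, Nat.cast_mul,
      Real.log_mul (by positivity) (by positivity), add_comm]

lemma sum_harmonicMean_expansion {x : ℝ} (hx : 0 < x) {N : ℕ} (hN : (N : ℝ) ≤ x) :
    |∑ b ∈ Icc 1 N, harmonicMean (x / b) - (x ^ 2 * Real.log x * sqSum N - x ^ 2 * logSqSum N
      + (Real.eulerMascheroniConstant - 3 / 2) * x ^ 2 * sqSum N + x * harmSum N - N / 12)|
      ≤ 24 * N ^ 2 / x := by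
  have e : x ^ 2 * Real.log x * sqSum N - x ^ 2 * logSqSum N
      + (Real.eulerMascheroniConstant - 3 / 2) * x ^ 2 * sqSum N + x * harmSum N - N / 12
      = ∑ b ∈ Icc 1 N, ((x / b) ^ 2 * Real.log (x / b)
        + (Real.eulerMascheroniConstant - 3 / 2) * (x / b) ^ 2 + x / b - 1 / 12) := by
    simp only [sqSum, logSqSum, harmSum, mul_sum]
    have : (N : ℝ) / 12 = ∑ b ∈ Icc 1 N, (1 / 12 : ℝ) := by simp; ring
    rw [this, ← sum_sub_distrib, ← sum_add_distrib, ← sum_add_distrib, ← sum_sub_distrib]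
    refine sum_congr rfl fun b hb => ?_
    have hb : (0 : ℝ) < b := by have := (mem_Icc.1 hb).1; positivity
    rw [Real.log_div hx.ne' hb.ne']
    ring
  rw [e, ← sum_sub_distrib]
  refine (abs_sum_le_sum_abs _ _).trans ?_
  have : ∀ b ∈ Icc 1 N, |harmonicMean (x / b) - ((x / b) ^ 2 * Real.log (x / b)
        + (Real.eulerMascheroniConstant - 3 / 2) * (x / b) ^ 2 + x / b - 1 / 12)|
        ≤ 24 * N / x := by
    intro b hb
    obtain ⟨h1, h2⟩ := mem_Icc.1 hb
    have hb : (0 : ℝ) < b := by positivity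
    have hbN : (b : ℝ) ≤ N := by exact_mod_cast h2
    refine (harmonic_weighted_expansion (y := x / b) ?_).trans ?_
    · rw [le_div_iff₀ hb]; linarith
    · rw [div_div_eq_mul_div]; gcongr
  refine (sum_le_card_nsmul _ _ _ this).trans (le_of_eq ?_)
  simp; ring

lemma sum_squareMean_expansion {x : ℝ} (hx : 0 < x) {A : ℕ} (hA : (A : ℝ) ≤ x) :
    |∑ a ∈ Icc 1 A, (a : ℝ) * ∑ b ∈ Icc 1 ⌊x / a⌋₊, (x / a / b - 1) ^ 2
      - (zetaTwo * x ^ 2 * harmSum A - 2 * x * (A * Real.log x - Real.log A.factorial)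
        - 2 * Real.eulerMascheroniConstant * x * A - A * (A + 1) / 4)| ≤ 40 * A ^ 3 / x := by
  have e : zetaTwo * x ^ 2 * harmSum A - 2 * x * (A * Real.log x - Real.log A.factorial)
        - 2 * Real.eulerMascheroniConstant * x * A - A * (A + 1) / 4
      = ∑ a ∈ Icc 1 A, (a : ℝ) * (zetaTwo * (x / a) ^ 2 - 2 * (x / a) * Real.log (x / a)
      - 2 * Real.eulerMascheroniConstant * (x / a) - 1 / 2) := by
    have h : ∀ a ∈ Icc 1 A, (a : ℝ) * (zetaTwo * (x / a) ^ 2 - 2 * (x / a) * Real.log (x / a)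
      - 2 * Real.eulerMascheroniConstant * (x / a) - 1 / 2) = zetaTwo * x ^ 2 * (1 / (a : ℝ))
        - (2 * x * Real.log x - 2 * x * Real.log a)
        - 2 * Real.eulerMascheroniConstant * x - (1 / 2) * a := by
      intro a ha
      have ha : (0 : ℝ) < a := by have := (mem_Icc.1 ha).1; positivity
      rw [Real.log_div hx.ne' ha.ne']
      field_simp
    rw [sum_congr rfl h]
    simp only [sum_sub_distrib, ← mul_sum, sum_Icc_natCast, sum_log_Icc, harmSum, sum_const,
      Nat.card_Icc, nsmul_eq_mul]
    simp; ring
  rw [e, ← sum_sub_distrib]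
  refine (abs_sum_le_sum_abs _ _).trans ?_
  have : ∀ a ∈ Icc 1 A, |(a : ℝ) * ∑ b ∈ Icc 1 ⌊x / a⌋₊, (x / a / b - 1) ^ 2
      - (a : ℝ) * (zetaTwo * (x / a) ^ 2 - 2 * (x / a) * Real.log (x / a)
      - 2 * Real.eulerMascheroniConstant * (x / a) - 1 / 2)| ≤ 40 * A ^ 2 / x := by
    intro a ha
    obtain ⟨h1, h2⟩ := mem_Icc.1 ha
    have ha : (0 : ℝ) < a := by positivity
    have haN : (a : ℝ) ≤ A := by exact_mod_cast h2
    rw [← mul_sub, abs_mul, abs_of_pos ha]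
    calc _ ≤ (a : ℝ) * (40 / (x / a)) := by
          gcongr
          refine square_weighted_expansion (z := x / a) ?_
          rw [le_div_iff₀ ha]; linarith
      _ = 40 * a ^ 2 / x := by field_simp
      _ ≤ _ := by gcongr
  refine (sum_le_card_nsmul _ _ _ this).trans (le_of_eq ?_)
  simp; ring

/-- The main term of `divisorMean`. -/
noncomputable def divisorMeanMain (x : ℝ) : ℝ :=
  zetaTwo * x ^ 2 * Real.log x
    + ((Real.eulerMascheroniConstant - 3 / 2) * zetaTwo - logZetaTwo) * x ^ 2
    + x * Real.log x + (Real.eulerMascheroniConstant + Real.log (2 * Real.pi)) * x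

lemma harmSum_le (n : ℕ) : harmSum n ≤ n := by
  rw [harmSum]
  refine (sum_le_card_nsmul _ _ 1 fun a ha => ?_).trans (by simp)
  have : (1 : ℝ) ≤ a := by exact_mod_cast (mem_Icc.1 ha).1
  rw [div_le_one (by linarith)]; exact this

lemma harmSum_nonneg (n : ℕ) : 0 ≤ harmSum n := by
  rw [harmSum]; positivity

/-- Cancellation of all intermediate terms in the hyperbola method. -/
lemma divisorMean_cancellation {x B N A lx lB HA g Z LZ p lf S L H F K : ℝ} (hB : B = N + 1 / 2)
    (hB0 : B ≠ 0) :
    F + K - (x ^ 2 * HA * S - 2 * x * A * H + N * (A * (A + 1) / 2))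
      - (Z * x ^ 2 * lx + ((g - 3 / 2) * Z - LZ) * x ^ 2 + x * lx + (g + p) * x)
    = (F - (x ^ 2 * lx * S - x ^ 2 * L + (g - 3 / 2) * x ^ 2 * S + x * H - N / 12))
      + (K - (Z * x ^ 2 * HA - 2 * x * (A * lx - lf) - 2 * g * x * A - A * (A + 1) / 4))
      + x ^ 2 * (S - (Z - 1 / B)) * (lx + (g - 3 / 2) - HA)
      - x ^ 2 * (L - (LZ - (lB + 1) / B))
      + x * (H - (lB + g)) * (1 + 2 * A)
      + B * ((x / B) ^ 2 * HA - 2 * (x / B) * A * (lx - lB) + 2 * (x / B) * lf - A * (A + 1) / 2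
        - ((x / B) ^ 2 * (lx - lB) + (g - 5 / 2) * (x / B) ^ 2 + (x / B) * (lx - lB)
          + (x / B) * p + 1 / 12)) + 1 / 24 := by
  obtain rfl : N = B - 1 / 2 := by linarith
  field_simp
  ring

lemma divisorMean_expansion_of_one_le {t : ℝ} (ht : 1 ≤ t) :
    |divisorMean (t ^ 3) - divisorMeanMain (t ^ 3)| ≤ 1000 * t := by
  obtain ⟨x, hx⟩ : ∃ x, x = t ^ 3 := ⟨_, rfl⟩
  rw [← hx]
  have ht2 : 1 ≤ t ^ 2 := one_le_pow₀ ht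
  have hx1 : 1 ≤ x := hx ▸ one_le_pow₀ ht
  have ht2x : t ^ 2 ≤ x := by rw [hx]; nlinarith
  obtain ⟨N, hN⟩ : ∃ N, N = ⌊t ^ 2⌋₊ := ⟨_, rfl⟩
  have hN1 : 1 ≤ N := hN ▸ Nat.le_floor (by simpa using ht2)
  have hN1' : (1 : ℝ) ≤ N := by exact_mod_cast hN1
  have hNle : (N : ℝ) ≤ t ^ 2 := hN ▸ Nat.floor_le (by positivity)
  have hNlt : t ^ 2 < N + 1 := hN ▸ Nat.lt_floor_add_one _
  have hNhalf : t ^ 2 / 2 ≤ N := by linarith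
  obtain ⟨B, hB⟩ : ∃ B : ℝ, B = N + 1 / 2 := ⟨_, rfl⟩
  have hB1 : 1 ≤ B := by linarith
  have hB0 : 0 < B := by linarith
  have hBhalf : t ^ 2 / 2 ≤ B := by linarith
  have hBle : B ≤ 2 * t ^ 2 := by linarith
  obtain ⟨A, hA⟩ : ∃ A, A = ⌊x / B⌋₊ := ⟨_, rfl⟩
  have hxB : 0 ≤ x / B := by positivity
  have hAle : (A : ℝ) ≤ x / B := hA ▸ Nat.floor_le hxB
  have hAlt : x / B < A + 1 := hA ▸ Nat.lt_floor_add_one _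
  have hxB2 : x / B ≤ 2 * t := by
    rw [div_le_iff₀ hB0, hx]; nlinarith
  have hA2 : (A : ℝ) ≤ 2 * t := hAle.trans hxB2
  have hxBx : x / B ≤ x := div_le_self (by linarith) hB1
  have hAB : (A : ℝ) * B ≤ x := by rwa [le_div_iff₀ hB0] at hAle
  have hAB' : x < (A + 1) * B := by rwa [div_lt_iff₀ hB0] at hAlt
  have hA0 : (0 : ℝ) ≤ A := by positivity
  rw [divisorMean_hyperbola (by linarith) (N := N) (A := A)
    (Nat.le_floor (by linarith)) (Nat.le_floor (by linarith)) (by rw [hB] at hAB; nlinarith)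
    (by rw [hB] at hAB'; nlinarith)]
  have hF := sum_harmonicMean_expansion (x := x) (N := N) (by linarith) (by linarith)
  have hK := sum_squareMean_expansion (x := x) (A := A) (by linarith) (by linarith)
  have hS := sqSum_expansion hN1
  have hL := logSqSum_expansion hN1
  have hH := harmSum_midpoint_expansion hN1
  have hy : 1 / 2 ≤ x / B := by
    rw [le_div_iff₀ hB0]; nlinarith
  have hG := log_weighted_expansion hy
  rw [← hA, Real.log_div (by positivity) hB0.ne'] at hG
  rw [← hB] at hS hL hH
  rw [divisorMeanMain, divisorMean_cancellation (lB := Real.log B) (L := logSqSum N)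
    (lf := Real.log A.factorial) hB hB0.ne']
  have hlx0 : 0 ≤ Real.log x := Real.log_nonneg hx1
  have hlx : Real.log x ≤ 3 * t := by
    rw [hx, Real.log_pow]
    have := Real.log_le_self (show 0 ≤ t by linarith)
    push_cast; linarith
  have hlN : Real.log N ≤ 2 * t := by
    have h1 : Real.log N ≤ Real.log (t ^ 2) := Real.log_le_log (by linarith) hNle
    rw [Real.log_pow] at h1
    have := Real.log_le_self (show 0 ≤ t by linarith)
    push_cast at h1; linarith
  have hlN0 : 0 ≤ Real.log N := Real.log_nonneg hN1'
  have hg1 := Real.one_half_lt_eulerMascheroniConstant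
  have hg2 := Real.eulerMascheroniConstant_lt_two_thirds
  have hHA := harmSum_le A
  have hHA0 := harmSum_nonneg A
  have hN3 : x ^ 2 * (1 / (N : ℝ) ^ 3) ≤ 8 := by
    rw [mul_one_div, div_le_iff₀ (by positivity), hx]
    calc (t ^ 3) ^ 2 = 8 * (t ^ 2 / 2) ^ 3 := by ring
      _ ≤ _ := by gcongr
  have hN2 : x * (2 / (N : ℝ) ^ 2) ≤ 8 / t := by
    rw [← mul_div_assoc, div_le_div_iff₀ (by positivity) (by positivity), hx]
    calc t ^ 3 * 2 * t = 8 * (t ^ 2 / 2) ^ 2 := by ring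
      _ ≤ _ := by gcongr
  have c1 : 24 * (N : ℝ) ^ 2 / x ≤ 24 * t := by
    rw [div_le_iff₀ (by linarith), hx]
    calc 24 * (N : ℝ) ^ 2 ≤ 24 * (t ^ 2) ^ 2 := by gcongr
      _ = _ := by ring
  have c2 : 40 * (A : ℝ) ^ 3 / x ≤ 320 := by
    rw [div_le_iff₀ (by linarith), hx]
    calc 40 * (A : ℝ) ^ 3 ≤ 40 * (2 * t) ^ 3 := by gcongr
      _ = _ := by ring
  have c3 : |x ^ 2 * (sqSum N - (zetaTwo - 1 / B)) *
      (Real.log x + (Real.eulerMascheroniConstant - 3 / 2) - harmSum A)| ≤ 8 * (6 * t) := by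
    rw [abs_mul, abs_mul, abs_of_nonneg (show 0 ≤ x ^ 2 by positivity)]
    refine mul_le_mul ((mul_le_mul_of_nonneg_left hS (by positivity)).trans hN3) ?_
      (abs_nonneg _) (by norm_num)
    rw [abs_le]; constructor <;> linarith
  have c4 : |x ^ 2 * (logSqSum N - (logZetaTwo - (Real.log B + 1) / B))| ≤ 8 * (12 * t) := by
    rw [abs_mul, abs_of_nonneg (show 0 ≤ x ^ 2 by positivity)]
    calc _ ≤ x ^ 2 * (4 * (1 + Real.log N) / (N : ℝ) ^ 3) :=
          mul_le_mul_of_nonneg_left hL (by positivity)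
      _ = x ^ 2 * (1 / (N : ℝ) ^ 3) * (4 * (1 + Real.log N)) := by ring
      _ ≤ 8 * (12 * t) := mul_le_mul hN3 (by linarith) (by positivity) (by norm_num)
  have c5 : |x * (harmSum N - (Real.log B + Real.eulerMascheroniConstant)) * (1 + 2 * (A : ℝ))|
      ≤ 40 := by
    rw [abs_mul, abs_mul, abs_of_nonneg (show 0 ≤ x by linarith),
      abs_of_nonneg (show 0 ≤ 1 + 2 * (A : ℝ) by linarith)]
    calc _ ≤ 8 / t * (5 * t) := by
          refine mul_le_mul ((mul_le_mul_of_nonneg_left hH (by linarith)).trans hN2) (by linarith)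
            (by positivity) (by positivity)
      _ = 40 := by field_simp; norm_num
  have c6 : B * (70 / (x / B)) ≤ 280 * t := by
    rw [div_div_eq_mul_div, ← mul_div_assoc, div_le_iff₀ (by linarith), hx]
    calc B * (70 * B) = 70 * B ^ 2 := by ring
      _ ≤ 70 * (2 * t ^ 2) ^ 2 := by gcongr
      _ = _ := by ring
  have c7 := mul_le_mul_of_nonneg_left hG hB0.le
  rw [← abs_of_pos hB0, ← abs_mul, abs_of_pos hB0] at c7
  have d1 := abs_le.1 (hF.trans c1)
  have d2 := abs_le.1 (hK.trans c2)
  have d3 := abs_le.1 c3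
  have d4 := abs_le.1 c4
  have d5 := abs_le.1 c5
  have d6 := abs_le.1 (c7.trans c6)
  rw [abs_le]
  constructor <;> linarith

lemma divisorMeanMain_le_of_lt_one :
    ∃ C : ℝ, 0 < C ∧ ∀ t : ℝ, 0 < t → t ≤ 1 → |divisorMeanMain (t ^ 3)| ≤ C * t ^ 2 := by
  refine ⟨|zetaTwo| * 3 + |(Real.eulerMascheroniConstant - 3 / 2) * zetaTwo - logZetaTwo| + 3
    + |Real.eulerMascheroniConstant + Real.log (2 * Real.pi)|, by positivity, fun t h0 h1 => ?_⟩
  have hlog : |t ^ 3 * Real.log (t ^ 3)| ≤ 3 * t ^ 2 := by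
    have h := Real.abs_log_mul_self_lt t h0 h1
    rw [Real.log_pow, show t ^ 3 * ((3 : ℕ) * Real.log t) = 3 * t ^ 2 * (Real.log t * t) by
      push_cast; ring, abs_mul, abs_of_nonneg (by positivity : 0 ≤ 3 * t ^ 2)]
    nlinarith [sq_nonneg t]
  have h32 : t ^ 3 ≤ t ^ 2 := pow_le_pow_of_le_one h0.le h1 (by norm_num)
  have h31 : t ^ 3 ≤ 1 := pow_le_one₀ h0.le h1
  have h62 : (t ^ 3) ^ 2 ≤ t ^ 2 := by
    rw [← pow_mul]; exact pow_le_pow_of_le_one h0.le h1 (by norm_num)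
  have e : divisorMeanMain (t ^ 3) = zetaTwo * (t ^ 3 * (t ^ 3 * Real.log (t ^ 3)))
    + ((Real.eulerMascheroniConstant - 3 / 2) * zetaTwo - logZetaTwo) * (t ^ 3) ^ 2
    + t ^ 3 * Real.log (t ^ 3) + (Real.eulerMascheroniConstant + Real.log (2 * Real.pi)) * t ^ 3 := by
    rw [divisorMeanMain]; ring
  rw [e]
  refine (abs_add_le _ _).trans ?_
  refine (add_le_add_left ((abs_add_le _ _).trans
    (add_le_add_left (abs_add_le _ _) _)) _).trans ?_
  rw [abs_mul, abs_mul, abs_mul _ (t ^ 3), abs_mul (t ^ 3), abs_mul _ ((t ^ 3) ^ 2),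
    abs_of_nonneg (by positivity : 0 ≤ t ^ 3),
    abs_of_nonneg (by positivity : 0 ≤ (t ^ 3) ^ 2)]
  rw [abs_mul (t ^ 3), abs_of_nonneg (by positivity : 0 ≤ t ^ 3)] at hlog
  have : t ^ 3 * (t ^ 3 * |Real.log (t ^ 3)|) ≤ 1 * (3 * t ^ 2) := by gcongr
  calc _ ≤ |zetaTwo| * (1 * (3 * t ^ 2))
      + |(Real.eulerMascheroniConstant - 3 / 2) * zetaTwo - logZetaTwo| * t ^ 2 + 3 * t ^ 2
      + |Real.eulerMascheroniConstant + Real.log (2 * Real.pi)| * t ^ 2 := by gcongr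
    _ = _ := by ring

lemma divisorMean_eq_zero {x : ℝ} (hx : x < 1) : divisorMean x = 0 := by
  rw [divisorMean, Nat.floor_eq_zero.2 hx]; simp

lemma divisorMean_expansion :
    ∃ C : ℝ, 0 < C ∧ ∀ t : ℝ, 0 < t →
      |divisorMean (t ^ 3) - divisorMeanMain (t ^ 3)| ≤ C * min t (t ^ 2) := by
  obtain ⟨C, hC, h⟩ := divisorMeanMain_le_of_lt_one
  refine ⟨max C 1000, by positivity, fun t ht => ?_⟩
  rcases lt_or_ge t 1 with h1 | h1
  · rw [divisorMean_eq_zero (pow_lt_one₀ ht.le h1 (by norm_num)), zero_sub, abs_neg,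
      min_eq_right (by nlinarith)]
    exact (h t ht h1.le).trans (by gcongr; exact le_max_left _ _)
  · rw [min_eq_left (by nlinarith)]
    exact (divisorMean_expansion_of_one_le h1).trans (by gcongr; exact le_max_right _ _)

lemma squarefree_prod_primeFactors (k : ℕ) : Squarefree (∏ p ∈ k.primeFactors, p) := by
  refine Finset.squarefree_prod_of_pairwise_isCoprime (fun p hp q hq hpq => ?_)
    fun p hp => (Nat.prime_of_mem_primeFactors hp).squarefree
  exact Nat.coprime_iff_isRelPrime.1 ((Nat.coprime_primes (Nat.prime_of_mem_primeFactors hp)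
    (Nat.prime_of_mem_primeFactors hq)).2 hpq)

lemma sum_divisors_eq_prod_of_squarefree_support {f : ArithmeticFunction ℝ}
    (hf : f.IsMultiplicative) (h0 : ∀ n, ¬ Squarefree n → f n = 0) {k : ℕ} (hk : k ≠ 0) :
    ∑ n ∈ k.divisors, f n = ∏ p ∈ k.primeFactors, (1 + f p) := by
  have hr := squarefree_prod_primeFactors k
  have h := hf.prodPrimeFactors_one_add_of_squarefree hr
  rw [Nat.primeFactors_prod (fun p hp => Nat.prime_of_mem_primeFactors hp)] at h
  rw [h]
  symm
  refine sum_subset (Nat.divisors_subset_of_dvd hk (Nat.prod_primeFactors_dvd k)) ?_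
  intro n hn hn'
  refine h0 n fun hsq => hn' ?_
  rw [Nat.mem_divisors] at hn ⊢
  refine ⟨?_, hr.ne_zero⟩
  rw [← Nat.prod_primeFactors_of_squarefree hsq]
  exact prod_dvd_prod_of_subset _ _ _ (Nat.primeFactors_mono hn.1 hk)

/-- The arithmetic function `n ↦ μ(n)² / φ(n)`. -/
noncomputable def sqfreeInvTotient : ArithmeticFunction ℝ :=
  ⟨fun n => (ArithmeticFunction.moebius n : ℝ) ^ 2 / (Nat.totient n : ℝ), by simp⟩

lemma sqfreeInvTotient_apply (n : ℕ) : sqfreeInvTotient n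
    = (ArithmeticFunction.moebius n : ℝ) ^ 2 / (Nat.totient n : ℝ) := rfl

lemma sqfreeInvTotient_of_not_squarefree {n : ℕ} (hn : ¬ Squarefree n) :
    sqfreeInvTotient n = 0 := by
  simp [sqfreeInvTotient_apply, ArithmeticFunction.moebius_eq_zero_of_not_squarefree hn]

lemma sqfreeInvTotient_of_squarefree {n : ℕ} (hn : Squarefree n) :
    sqfreeInvTotient n = 1 / (Nat.totient n : ℝ) := by
  have h := ArithmeticFunction.moebius_sq_eq_one_of_squarefree hn
  have h' : (ArithmeticFunction.moebius n : ℝ) ^ 2 = 1 := by exact_mod_cast h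
  rw [sqfreeInvTotient_apply, h']

lemma sqfreeInvTotient_prime {p : ℕ} (hp : p.Prime) :
    sqfreeInvTotient p = 1 / ((p : ℝ) - 1) := by
  rw [sqfreeInvTotient_of_squarefree hp.squarefree, Nat.totient_prime hp,
    Nat.cast_sub hp.one_le, Nat.cast_one]

lemma sqfreeInvTotient_nonneg (n : ℕ) : 0 ≤ sqfreeInvTotient n := by
  rw [sqfreeInvTotient_apply]; positivity

lemma sqfreeInvTotient_le (n : ℕ) : sqfreeInvTotient n ≤ 1 / (Nat.totient n : ℝ) := by
  by_cases hn : Squarefree n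
  · rw [sqfreeInvTotient_of_squarefree hn]
  · rw [sqfreeInvTotient_of_not_squarefree hn]; positivity

lemma isMultiplicative_sqfreeInvTotient : sqfreeInvTotient.IsMultiplicative := by
  refine ⟨by simp [sqfreeInvTotient_apply], fun {m n} h => ?_⟩
  simp only [sqfreeInvTotient_apply, Nat.totient_mul h,
    ArithmeticFunction.isMultiplicative_moebius.map_mul_of_coprime h]
  push_cast
  ring

lemma prod_one_add_inv_eq_div_totient {k : ℕ} (hk : k ≠ 0) :
    ∏ p ∈ k.primeFactors, (1 + sqfreeInvTotient p) = (k : ℝ) / Nat.totient k := by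
  have h := Nat.totient_eq_mul_prod_factors k
  have h' : (Nat.totient k : ℝ) = k * ∏ p ∈ k.primeFactors, (1 - (p : ℝ)⁻¹) := by
    have := congrArg (fun q : ℚ => (q : ℝ)) h
    push_cast at this
    exact this
  have hφ : (0 : ℝ) < Nat.totient k := by exact_mod_cast Nat.totient_pos.2 (Nat.pos_of_ne_zero hk)
  have hk' : (0 : ℝ) < k := by positivity
  rw [eq_div_iff hφ.ne', h', mul_left_comm, ← prod_mul_distrib, prod_congr rfl (g := fun _ => 1)]
  · simp
  · intro p hp
    have hpp := Nat.prime_of_mem_primeFactors hp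
    have : (1 : ℝ) < p := by exact_mod_cast hpp.one_lt
    rw [sqfreeInvTotient_prime hpp]
    have : (p : ℝ) - 1 ≠ 0 := by linarith
    field_simp
    ring

lemma sum_divisors_sqfreeInvTotient {k : ℕ} (hk : k ≠ 0) :
    ∑ n ∈ k.divisors, sqfreeInvTotient n = (k : ℝ) / Nat.totient k := by
  rw [sum_divisors_eq_prod_of_squarefree_support isMultiplicative_sqfreeInvTotient
    (fun n => sqfreeInvTotient_of_not_squarefree) hk, prod_one_add_inv_eq_div_totient hk]

/-- The coefficients of the Dirichlet series `∑ μ(n)² n / φ(n) n⁻ˢ / ζ(s)` before grouping by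
the product of the two variables. -/
noncomputable def pairCoeff (n d : ℕ) : ℝ :=
  if d ∣ n then sqfreeInvTotient n * ArithmeticFunction.moebius d * d else 0

/-- The coefficients of the Dirichlet series `∑ μ(n)² n / φ(n) n⁻ˢ / ζ(s)`. -/
noncomputable def groupedCoeff (e : ℕ) : ℝ :=
  ∑ p ∈ e.divisorsAntidiagonal, pairCoeff p.1 p.2

lemma sum_divisors_sum_divisorsAntidiagonal (k : ℕ) (c : ℕ → ℕ → ℝ) :
    ∑ e ∈ k.divisors, ∑ p ∈ e.divisorsAntidiagonal, c p.1 p.2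
      = ∑ n ∈ k.divisors, ∑ d ∈ (k / n).divisors, c n d := by
  rw [sum_sigma', sum_sigma']
  refine sum_nbij' (fun x => ⟨x.2.1, x.2.2⟩) (fun y => ⟨y.1 * y.2, (y.1, y.2)⟩) ?_ ?_ ?_ ?_ ?_
  · rintro ⟨e, n, d⟩ h
    simp only [mem_sigma, Nat.mem_divisors, Nat.mem_divisorsAntidiagonal] at h ⊢
    obtain ⟨⟨h1, h2⟩, rfl, h3⟩ := h
    have hn : 0 < n := Nat.pos_of_ne_zero fun h => h3 (by simp [h])
    refine ⟨⟨(Dvd.intro _ rfl).trans h1, h2⟩, ?_, ?_⟩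
    · exact (Nat.dvd_div_iff_mul_dvd ((Dvd.intro _ rfl).trans h1)).2 h1
    · exact (Nat.div_pos (Nat.le_of_dvd (Nat.pos_of_ne_zero h2) ((Dvd.intro _ rfl).trans h1)) hn).ne'
  · rintro ⟨n, d⟩ h
    simp only [mem_sigma, Nat.mem_divisors, Nat.mem_divisorsAntidiagonal] at h ⊢
    obtain ⟨⟨h1, h2⟩, h3, h4⟩ := h
    have h5 := (Nat.dvd_div_iff_mul_dvd h1).1 h3
    exact ⟨⟨h5, h2⟩, trivial, fun h => h2 (by rw [h] at h5; exact zero_dvd_iff.1 h5)⟩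
  · rintro ⟨e, n, d⟩ h
    simp only [mem_sigma, Nat.mem_divisorsAntidiagonal] at h
    obtain ⟨_, rfl, _⟩ := h
    rfl
  · rintro ⟨n, d⟩ _; rfl
  · rintro ⟨e, n, d⟩ _; rfl

lemma primeFactors_gcd_div {n k : ℕ} (hn : Squarefree n) (hnk : n ∣ k) (hk : k ≠ 0) :
    (n.gcd (k / n)).primeFactors = n.primeFactors.filter (fun p => p ^ 2 ∣ k) := by
  ext p
  have hn0 := hn.ne_zero
  have hg : n.gcd (k / n) ≠ 0 := Nat.gcd_ne_zero_left hn0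
  simp only [mem_filter, Nat.mem_primeFactors, Nat.dvd_gcd_iff]
  constructor
  · rintro ⟨hp, ⟨h1, h2⟩, -⟩
    refine ⟨⟨hp, h1, hn0⟩, ?_⟩
    obtain ⟨m, rfl⟩ := hnk
    rw [Nat.mul_div_cancel_left _ (Nat.pos_of_ne_zero hn0)] at h2
    rw [sq]; exact mul_dvd_mul h1 h2
  · rintro ⟨⟨hp, h1, -⟩, h2⟩
    refine ⟨hp, ⟨h1, ?_⟩, hg⟩
    obtain ⟨m, rfl⟩ := hnk
    rw [Nat.mul_div_cancel_left _ (Nat.pos_of_ne_zero hn0)]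
    obtain ⟨l, rfl⟩ := h1
    have hl : ¬ p ∣ l := fun h => hp.not_isUnit (hn p (mul_dvd_mul_left p h))
    rw [sq, mul_assoc] at h2
    have := (Nat.mul_dvd_mul_iff_left hp.pos).1 h2
    exact (hp.dvd_mul.1 this).resolve_left hl

lemma sum_pairCoeff {n k : ℕ} (hnk : n ∣ k) (hk : k ≠ 0) :
    ∑ d ∈ (k / n).divisors, pairCoeff n d
      = sqfreeInvTotient n * ∏ p ∈ n.primeFactors, (if p ^ 2 ∣ k then 1 - (p : ℝ) else 1) := by
  by_cases hn : Squarefree n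
  · have hgs : Squarefree (n.gcd (k / n)) := hn.squarefree_of_dvd (Nat.gcd_dvd_left _ _)
    have hmult : ((ArithmeticFunction.id : ArithmeticFunction ℝ)).IsMultiplicative :=
      ArithmeticFunction.isMultiplicative_id.natCast
    have key := hmult.prodPrimeFactors_one_sub_of_squarefree _ hgs
    rw [primeFactors_gcd_div hn hnk hk] at key
    rw [← prod_filter_mul_prod_filter_not _ (fun p => p ^ 2 ∣ k)]
    rw [prod_congr rfl (g := fun p : ℕ => 1 - (p : ℝ)) (fun p hp => if_pos (mem_filter.1 hp).2),
      prod_congr rfl (g := fun p : ℕ => (1 : ℝ))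
        (s₁ := n.primeFactors.filter fun p => ¬ p ^ 2 ∣ k)
        (fun p hp => if_neg (mem_filter.1 hp).2), prod_const_one, mul_one]
    simp only [ArithmeticFunction.natCoe_apply, ArithmeticFunction.id_apply] at key
    rw [key, mul_sum]
    simp only [pairCoeff]
    rw [← sum_filter]
    have hkn : k / n ≠ 0 := (Nat.div_pos (Nat.le_of_dvd (Nat.pos_of_ne_zero hk) hnk)
      (Nat.pos_of_ne_zero hn.ne_zero)).ne'
    refine sum_congr ?_ fun d _ => by ring
    ext d
    simp only [mem_filter, Nat.mem_divisors, Nat.dvd_gcd_iff]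
    constructor
    · rintro ⟨⟨h1, h2⟩, h3⟩; exact ⟨⟨h3, h1⟩, hgs.ne_zero⟩
    · rintro ⟨⟨h1, h2⟩, h3⟩; exact ⟨⟨h2, hkn⟩, h1⟩
  · simp [pairCoeff, sqfreeInvTotient_of_not_squarefree hn]

lemma sum_divisors_groupedCoeff {k : ℕ} (hk : k ≠ 0) :
    ∑ e ∈ k.divisors, groupedCoeff e = k * sqfreeInvTotient k := by
  simp only [groupedCoeff]
  rw [sum_divisors_sum_divisorsAntidiagonal]
  have h : ∀ n ∈ k.divisors, ∑ d ∈ (k / n).divisors, pairCoeff n d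
      = (sqfreeInvTotient.pmul (ArithmeticFunction.prodPrimeFactors
        fun p => if p ^ 2 ∣ k then 1 - (p : ℝ) else 1)) n := by
    intro n hn
    have hnk := Nat.dvd_of_mem_divisors hn
    rw [sum_pairCoeff hnk hk, ArithmeticFunction.pmul_apply,
      ArithmeticFunction.prodPrimeFactors_apply (ne_zero_of_dvd_ne_zero hk hnk)]
  rw [sum_congr rfl h, sum_divisors_eq_prod_of_squarefree_support
    (isMultiplicative_sqfreeInvTotient.pmul
      (ArithmeticFunction.IsMultiplicative.prodPrimeFactors _))
    (fun n hn => by simp [sqfreeInvTotient_of_not_squarefree hn]) hk]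
  have h2 : ∀ p ∈ k.primeFactors, (1 + (sqfreeInvTotient.pmul
      (ArithmeticFunction.prodPrimeFactors fun p => if p ^ 2 ∣ k then 1 - (p : ℝ) else 1)) p)
      = if p ^ 2 ∣ k then 0 else 1 + sqfreeInvTotient p := by
    intro p hp
    have hpp := Nat.prime_of_mem_primeFactors hp
    rw [ArithmeticFunction.pmul_apply, ArithmeticFunction.prodPrimeFactors_apply hpp.ne_zero,
      hpp.primeFactors, prod_singleton]
    split_ifs
    · have : (1 : ℝ) < p := by exact_mod_cast hpp.one_lt
      have : (p : ℝ) - 1 ≠ 0 := by linarith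
      rw [sqfreeInvTotient_prime hpp]
      field_simp
      ring
    · ring
  rw [prod_congr rfl h2]
  by_cases hs : Squarefree k
  · rw [sqfreeInvTotient_of_squarefree hs, mul_one_div, ← prod_one_add_inv_eq_div_totient hk]
    refine prod_congr rfl fun p hp => if_neg fun h => ?_
    rw [sq] at h
    exact (Nat.prime_of_mem_primeFactors hp).not_isUnit (hs p h)
  · rw [sqfreeInvTotient_of_not_squarefree hs, mul_zero]
    rw [Nat.squarefree_iff_prime_squarefree] at hs
    push Not at hs
    obtain ⟨p, hp, hpk⟩ := hs
    refine prod_eq_zero (i := p) (Nat.mem_primeFactors.2 ⟨hp, (Dvd.intro _ rfl).trans hpk, hk⟩) ?_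
    rw [if_pos (by rwa [sq])]

lemma sum_Icc_divisorsAntidiagonal (X : ℕ) (f : ℕ → ℕ → ℝ) :
    ∑ h ∈ Icc 1 X, ∑ p ∈ h.divisorsAntidiagonal, f p.1 p.2
      = ∑ u ∈ Icc 1 X, ∑ v ∈ Icc 1 (X / u), f u v := by
  rw [sum_sigma', sum_sigma']
  refine sum_nbij' (fun x => ⟨x.2.1, x.2.2⟩) (fun y => ⟨y.1 * y.2, (y.1, y.2)⟩) ?_ ?_ ?_ ?_ ?_
  · rintro ⟨e, n, d⟩ h
    simp only [mem_sigma, mem_Icc, Nat.mem_divisorsAntidiagonal] at h ⊢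
    obtain ⟨⟨h1, h2⟩, rfl, h3⟩ := h
    have hn : 0 < n := Nat.pos_of_ne_zero fun h => h3 (by simp [h])
    have hd : 0 < d := Nat.pos_of_ne_zero fun h => h3 (by simp [h])
    refine ⟨⟨hn, (Nat.le_mul_of_pos_right n hd).trans h2⟩, hd, ?_⟩
    rw [Nat.le_div_iff_mul_le hn, mul_comm]; exact h2
  · rintro ⟨n, d⟩ h
    simp only [mem_sigma, mem_Icc, Nat.mem_divisorsAntidiagonal] at h ⊢
    obtain ⟨⟨h1, h2⟩, h3, h4⟩ := h
    rw [Nat.le_div_iff_mul_le h1, mul_comm] at h4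
    have : 0 < n * d := Nat.mul_pos h1 h3
    exact ⟨⟨this, h4⟩, trivial, this.ne'⟩
  · rintro ⟨e, n, d⟩ h
    simp only [mem_sigma, Nat.mem_divisorsAntidiagonal] at h
    obtain ⟨_, rfl, _⟩ := h
    rfl
  · rintro ⟨n, d⟩ _; rfl
  · rintro ⟨e, n, d⟩ _; rfl

lemma sum_Icc_sum_divisors (X : ℕ) (a g : ℕ → ℝ) :
    ∑ h ∈ Icc 1 X, (∑ u ∈ h.divisors, a u) * g h
      = ∑ u ∈ Icc 1 X, a u * ∑ v ∈ Icc 1 (X / u), g (u * v) := by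
  simp only [mul_sum]
  rw [← sum_Icc_divisorsAntidiagonal X (fun u v => a u * g (u * v))]
  refine sum_congr rfl fun h _ => ?_
  rw [sum_mul, ← Nat.sum_divisorsAntidiagonal (fun u _ => a u * g h)]
  refine sum_congr rfl fun p hp => ?_
  rw [(Nat.mem_divisorsAntidiagonal.1 hp).1]

lemma sum_sq_div_totient_eq (H : ℝ) :
    ∑ h ∈ Icc 1 ⌊H⌋₊, (H - (h : ℝ)) ^ 2 / (Nat.totient h : ℝ)
      = ∑ e ∈ Icc 1 ⌊H⌋₊, groupedCoeff e * divisorMean (H / e) := by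
  calc _ = ∑ h ∈ Icc 1 ⌊H⌋₊, (∑ u ∈ h.divisors, sqfreeInvTotient u) * ((H - h) ^ 2 / h) := by
        refine sum_congr rfl fun h hh => ?_
        have h0 : h ≠ 0 := by have := (mem_Icc.1 hh).1; omega
        rw [sum_divisors_sqfreeInvTotient h0]
        have : (h : ℝ) ≠ 0 := by exact_mod_cast h0
        have : (Nat.totient h : ℝ) ≠ 0 := by
          exact_mod_cast (Nat.totient_pos.2 (Nat.pos_of_ne_zero h0)).ne'
        field_simp
    _ = ∑ u ∈ Icc 1 ⌊H⌋₊, (∑ e ∈ u.divisors, groupedCoeff e) * harmonicMean (H / u) := by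
        rw [sum_Icc_sum_divisors]
        refine sum_congr rfl fun u hu => ?_
        have h0 : u ≠ 0 := by have := (mem_Icc.1 hu).1; omega
        have h0' : (u : ℝ) ≠ 0 := by exact_mod_cast h0
        rw [sum_divisors_groupedCoeff h0, harmonicMean, Nat.floor_div_natCast, mul_comm (u : ℝ),
          mul_assoc, mul_sum _ _ (u : ℝ)]
        congr 1
        refine sum_congr rfl fun v hv => ?_
        have h1' : (v : ℝ) ≠ 0 := by have := (mem_Icc.1 hv).1; positivity
        push_cast
        field_simp
    _ = _ := by
        rw [sum_Icc_sum_divisors]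
        refine sum_congr rfl fun e he => ?_
        rw [divisorMean, Nat.floor_div_natCast]
        congr 1
        refine sum_congr rfl fun v hv => ?_
        push_cast
        rw [div_div]

lemma sum_div_totient_mul (X : ℕ) (g : ℕ → ℝ) :
    ∑ d ∈ Icc 1 X, (d : ℝ) / Nat.totient d * g d
      = ∑ u ∈ Icc 1 X, sqfreeInvTotient u * ∑ v ∈ Icc 1 (X / u), g (u * v) := by
  rw [← sum_Icc_sum_divisors]
  refine sum_congr rfl fun h hh => ?_
  rw [sum_divisors_sqfreeInvTotient]
  have := (mem_Icc.1 hh).1; omega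

lemma sqfreeInvTotient_le_one (n : ℕ) : sqfreeInvTotient n ≤ 1 := by
  refine (sqfreeInvTotient_le n).trans ?_
  rcases Nat.eq_zero_or_pos (Nat.totient n) with h | h
  · simp [h]
  · rw [div_le_one (by exact_mod_cast h)]; exact_mod_cast h

lemma sum_div_totient_rpow_le {s : ℝ} (hs : s < -1) :
    ∃ K : ℝ, 0 < K ∧ ∀ X : ℕ, ∑ d ∈ Icc 1 X, (d : ℝ) / Nat.totient d * (d : ℝ) ^ s ≤ K := by
  have hsum := Real.summable_nat_rpow.2 hs
  obtain ⟨B, hB⟩ : ∃ B, B = ∑' n : ℕ, (n : ℝ) ^ s := ⟨_, rfl⟩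
  have hle : ∀ X : ℕ, ∑ v ∈ Icc 1 X, (v : ℝ) ^ s ≤ B := fun X =>
    hB ▸ hsum.sum_le_tsum _ (fun _ _ => by positivity)
  have hB0 : 0 < B := by
    have := hle 1
    simp at this; linarith
  refine ⟨B * B, by positivity, fun X => ?_⟩
  rw [sum_div_totient_mul]
  calc _ ≤ ∑ u ∈ Icc 1 X, (u : ℝ) ^ s * B := by
        refine sum_le_sum fun u _ => ?_
        have : ∑ v ∈ Icc 1 (X / u), ((u * v : ℕ) : ℝ) ^ s
            = (u : ℝ) ^ s * ∑ v ∈ Icc 1 (X / u), (v : ℝ) ^ s := by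
          rw [mul_sum]
          refine sum_congr rfl fun v _ => ?_
          rw [Nat.cast_mul, Real.mul_rpow (by positivity) (by positivity)]
        rw [this]
        calc _ ≤ 1 * ((u : ℝ) ^ s * B) := by
              refine mul_le_mul (sqfreeInvTotient_le_one u) ?_ ?_ zero_le_one
              · gcongr; exact hle _
              · positivity
          _ = _ := one_mul _
    _ = (∑ u ∈ Icc 1 X, (u : ℝ) ^ s) * B := by rw [sum_mul]
    _ ≤ _ := by gcongr; exact hle X

/-- The weight `min (x ^ (1/3)) (x ^ (2/3))`. -/
noncomputable def cbrtWeight (x : ℝ) : ℝ := min (x ^ (1 / 3 : ℝ)) ((x ^ (1 / 3 : ℝ)) ^ 2)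

lemma cbrtWeight_nonneg {x : ℝ} (hx : 0 ≤ x) : 0 ≤ cbrtWeight x := by
  rw [cbrtWeight]; positivity

lemma cbrtWeight_increment {u v z : ℝ} (hu : 0 ≤ u) (hv : 0 < v) (hz : 0 < z)
    (h : v ^ 3 - u ^ 3 = 1 / z) :
    min ((1 / v) ^ 2) (((1 / v) ^ 2) ^ 2) ≤ 12 * z * (v / (1 + v) - u / (1 + u)) := by
  have hz' : z = 1 / (v ^ 3 - u ^ 3) := by rw [h]; field_simp
  have hpos : 0 < v ^ 3 - u ^ 3 := by rw [h]; positivity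
  have huv : u < v := lt_of_pow_lt_pow_left₀ 3 hv.le (by linarith)
  have hvu : 0 < v - u := by linarith
  have hq : 0 < v ^ 2 + v * u + u ^ 2 := by positivity
  have e : 12 * z * (v / (1 + v) - u / (1 + u))
      = 12 / ((v ^ 2 + v * u + u ^ 2) * ((1 + v) * (1 + u))) := by
    have h3 : v ^ 3 - u ^ 3 = (v - u) * (v ^ 2 + v * u + u ^ 2) := by ring
    rw [hz', h3]
    field_simp
    ring
  have hden : (v ^ 2 + v * u + u ^ 2) * ((1 + v) * (1 + u)) ≤ 3 * v ^ 2 * (1 + v) ^ 2 := by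
    have : v ^ 2 + v * u + u ^ 2 ≤ 3 * v ^ 2 := by nlinarith
    rw [sq (1 + v)]
    gcongr
  rw [e]
  refine le_trans ?_ (div_le_div_of_nonneg_left (by norm_num) (by positivity) hden)
  rcases le_total v 1 with h1 | h1
  · refine (min_le_left _ _).trans ?_
    rw [div_pow, one_pow, div_le_div_iff₀ (by positivity) (by positivity)]
    have : (1 + v) ^ 2 ≤ 4 := by nlinarith
    nlinarith [sq_nonneg v]
  · refine (min_le_right _ _).trans ?_
    rw [← pow_mul, div_pow, one_pow, div_le_div_iff₀ (by positivity) (by positivity)]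
    have : (1 + v) ^ 2 ≤ 4 * v ^ 2 := by nlinarith
    have h4 : v ^ (2 * 2) = v ^ 2 * v ^ 2 := by ring
    rw [h4]
    nlinarith [sq_nonneg v]

lemma sum_cbrtWeight_le {z : ℝ} (hz : 0 < z) (J : ℕ) :
    ∑ j ∈ Icc 1 J, cbrtWeight ((z / j) ^ 2) ≤ 12 * z := by
  have key : ∀ J : ℕ, ∑ j ∈ Icc 1 J, cbrtWeight ((z / j) ^ 2)
      ≤ 12 * z * (((J : ℝ) / z) ^ (1 / 3 : ℝ) / (1 + ((J : ℝ) / z) ^ (1 / 3 : ℝ))) := by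
    intro J
    induction J with
    | zero => simp
    | succ J ih =>
      rw [Finset.sum_Icc_succ_top (by omega)]
      have hcube : ∀ x : ℝ, 0 ≤ x → (x ^ (1 / 3 : ℝ)) ^ 3 = x := by
        intro x hx
        rw [← Real.rpow_natCast, ← Real.rpow_mul hx]; norm_num
      have hJ : (0 : ℝ) < ((J + 1 : ℕ) : ℝ) / z := by positivity
      obtain ⟨v, hv⟩ : ∃ v, v = (((J + 1 : ℕ) : ℝ) / z) ^ (1 / 3 : ℝ) := ⟨_, rfl⟩
      obtain ⟨u, hu⟩ : ∃ u, u = ((J : ℝ) / z) ^ (1 / 3 : ℝ) := ⟨_, rfl⟩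
      have hv0 : 0 < v := by rw [hv]; positivity
      have hu0 : 0 ≤ u := by rw [hu]; positivity
      have h := cbrtWeight_increment hu0 hv0 hz (by
        rw [hv, hu, hcube _ hJ.le, hcube _ (by positivity)]; push_cast; ring)
      have hw : ((z / ((J + 1 : ℕ) : ℝ)) ^ 2) ^ (1 / 3 : ℝ) = (1 / v) ^ 2 := by
        have h1 : z / ((J + 1 : ℕ) : ℝ) = (((J + 1 : ℕ) : ℝ) / z)⁻¹ := by rw [inv_div]
        rw [h1, hv, ← Real.rpow_natCast, ← Real.rpow_natCast, ← Real.rpow_mul (by positivity),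
          mul_comm, Real.rpow_mul (by positivity), Real.inv_rpow hJ.le]
        simp only [one_div]
      rw [← hu] at ih
      rw [cbrtWeight, hw, ← hv]
      linarith
  refine (key J).trans ?_
  have : ((J : ℝ) / z) ^ (1 / 3 : ℝ) / (1 + ((J : ℝ) / z) ^ (1 / 3 : ℝ)) ≤ 1 := by
    have : 0 ≤ ((J : ℝ) / z) ^ (1 / 3 : ℝ) := by positivity
    rw [div_le_one (by positivity)]; linarith
  nlinarith

lemma sqfreeInvTotient_mul_le (d m : ℕ) :
    sqfreeInvTotient (d * m) * d ≤ 1 / (Nat.totient m : ℝ) * ((d : ℝ) / Nat.totient d) := by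
  by_cases h : Squarefree (d * m)
  · rw [sqfreeInvTotient_of_squarefree h,
      Nat.totient_mul (Nat.coprime_of_squarefree_mul h)]
    push_cast
    apply le_of_eq
    rw [one_div, mul_inv]; ring
  · rw [sqfreeInvTotient_of_not_squarefree h, zero_mul]; positivity

lemma abs_pairCoeff_mul_le (d m : ℕ) :
    |pairCoeff (d * m) d| ≤ 1 / (Nat.totient m : ℝ) * ((d : ℝ) / Nat.totient d) := by
  rw [pairCoeff, if_pos (Dvd.intro _ rfl), abs_mul, abs_mul,
    abs_of_nonneg (sqfreeInvTotient_nonneg _), Nat.abs_cast]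
  refine le_trans ?_ (sqfreeInvTotient_mul_le d m)
  have h : |(ArithmeticFunction.moebius d : ℝ)| ≤ 1 := by
    exact_mod_cast ArithmeticFunction.abs_moebius_le_one
  have := sqfreeInvTotient_nonneg (d * m)
  calc _ ≤ sqfreeInvTotient (d * m) * 1 * d := by gcongr
    _ = _ := by ring

lemma sum_Icc_dvd (X : ℕ) {d : ℕ} (hd : 0 < d) (f : ℕ → ℝ) :
    ∑ n ∈ Icc 1 X, (if d ∣ n then f n else 0) = ∑ m ∈ Icc 1 (X / d), f (d * m) := by
  rw [← sum_filter]
  symm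
  refine sum_nbij (fun m => d * m) ?_ ?_ ?_ (fun _ _ => rfl)
  · intro m hm
    simp only [mem_filter, mem_Icc] at hm ⊢
    refine ⟨⟨Nat.mul_pos hd hm.1, ?_⟩, Dvd.intro _ rfl⟩
    rw [mul_comm]; exact (Nat.le_div_iff_mul_le hd).1 hm.2
  · intro a _ b _ h
    exact Nat.eq_of_mul_eq_mul_left hd h
  · rintro n hn
    simp only [coe_filter, mem_Icc, Set.mem_ofPred_eq] at hn
    obtain ⟨⟨h1, h2⟩, m, rfl⟩ := hn
    refine ⟨m, ?_, rfl⟩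
    simp only [coe_Icc, Set.mem_Icc]
    exact ⟨Nat.pos_of_mul_pos_left h1, (Nat.le_div_iff_mul_le hd).2 (by rwa [mul_comm])⟩

lemma sum_abs_pairCoeff_mul_cbrtWeight_le :
    ∃ K : ℝ, 0 < K ∧ ∀ (H : ℝ) (X : ℕ), 0 < H →
      ∑ n ∈ Icc 1 X, ∑ d ∈ Icc 1 X, |pairCoeff n d| * cbrtWeight (H / (n * d)) ≤ K * √H := by
  obtain ⟨K₁, hK₁, h1⟩ := sum_div_totient_rpow_le (s := -2) (by norm_num)
  obtain ⟨K₂, hK₂, h2⟩ := sum_div_totient_rpow_le (s := -(3 / 2)) (by norm_num)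
  refine ⟨K₂ * (12 * K₁), by positivity, fun H X hH => ?_⟩
  have inner : ∀ Y : ℝ, 0 < Y →
      ∑ d ∈ Icc 1 X, (d : ℝ) / Nat.totient d * cbrtWeight ((Y / d) ^ 2) ≤ 12 * K₁ * Y := by
    intro Y hY
    rw [sum_div_totient_mul X (fun d => cbrtWeight ((Y / d) ^ 2))]
    calc _ ≤ ∑ u ∈ Icc 1 X, 12 * Y * ((u : ℝ) / Nat.totient u * (u : ℝ) ^ (-2 : ℝ)) := by
          refine sum_le_sum fun u hu => ?_
          have hu0 : (0 : ℝ) < u := by have := (mem_Icc.1 hu).1; positivity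
          have hb := sum_cbrtWeight_le (z := Y / u) (by positivity) (X / u)
          simp only [Nat.cast_mul, ← div_div]
          calc _ ≤ 1 / (Nat.totient u : ℝ) * (12 * (Y / u)) :=
                mul_le_mul (sqfreeInvTotient_le u) hb
                  (sum_nonneg fun _ _ => cbrtWeight_nonneg (by positivity)) (by positivity)
            _ = _ := by
                rw [Real.rpow_neg hu0.le, Real.rpow_two]
                field_simp
      _ = 12 * Y * ∑ u ∈ Icc 1 X, (u : ℝ) / Nat.totient u * (u : ℝ) ^ (-2 : ℝ) := by
          rw [mul_sum]
      _ ≤ 12 * Y * K₁ := by gcongr; exact h1 X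
      _ = _ := by ring
  calc _ = ∑ d ∈ Icc 1 X, ∑ n ∈ Icc 1 X,
        (if d ∣ n then |pairCoeff n d| * cbrtWeight (H / (n * d)) else 0) := by
        rw [sum_comm]
        refine sum_congr rfl fun d _ => sum_congr rfl fun n _ => ?_
        split_ifs with h
        · rfl
        · simp [pairCoeff, h]
    _ ≤ ∑ d ∈ Icc 1 X, ∑ m ∈ Icc 1 X, 1 / (Nat.totient m : ℝ) *
        ((d : ℝ) / Nat.totient d * cbrtWeight ((√H / √m / d) ^ 2)) := by
        refine sum_le_sum fun d hd => ?_
        have hd0 := (mem_Icc.1 hd).1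
        rw [sum_Icc_dvd X hd0 (fun n => |pairCoeff n d| * cbrtWeight (H / (n * d)))]
        refine (sum_le_sum_of_subset_of_nonneg (t := Icc 1 X)
          (Icc_subset_Icc le_rfl (Nat.div_le_self _ _)) fun m _ _ => ?_).trans
          (sum_le_sum fun m hm => ?_)
        · exact mul_nonneg (abs_nonneg _) (cbrtWeight_nonneg (by positivity))
        · have e : (√H / √m / d) ^ 2 = H / ((d * m : ℕ) * d) := by
            rw [div_pow, div_pow, Real.sq_sqrt hH.le, Real.sq_sqrt (by positivity)]
            push_cast
            rw [div_div]; congr 1; ring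
          rw [e, ← mul_assoc]
          exact mul_le_mul_of_nonneg_right (abs_pairCoeff_mul_le d m)
            (cbrtWeight_nonneg (by positivity))
    _ = ∑ m ∈ Icc 1 X, 1 / (Nat.totient m : ℝ) * ∑ d ∈ Icc 1 X,
        ((d : ℝ) / Nat.totient d * cbrtWeight ((√H / √m / d) ^ 2)) := by
        rw [sum_comm]; simp only [mul_sum]
    _ ≤ ∑ m ∈ Icc 1 X, 12 * K₁ * √H * ((m : ℝ) / Nat.totient m * (m : ℝ) ^ (-(3 / 2) : ℝ)) := by
        refine sum_le_sum fun m hm => ?_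
        have hm0 : (0 : ℝ) < m := by have := (mem_Icc.1 hm).1; positivity
        have e : (m : ℝ) ^ (-(3 / 2) : ℝ) = 1 / (m * √m) := by
          rw [Real.rpow_neg hm0.le, show (3 / 2 : ℝ) = 1 + 1 / 2 by norm_num,
            Real.rpow_add hm0, Real.rpow_one, ← Real.sqrt_eq_rpow, one_div]
        calc _ ≤ 1 / (Nat.totient m : ℝ) * (12 * K₁ * (√H / √m)) := by
              gcongr; exact inner _ (by positivity)
          _ = _ := by
              rw [e]
              have : √(m : ℝ) ≠ 0 := by positivity
              field_simp
    _ = 12 * K₁ * √H * ∑ m ∈ Icc 1 X, ((m : ℝ) / Nat.totient m * (m : ℝ) ^ (-(3 / 2) : ℝ)) := by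
        rw [mul_sum]
    _ ≤ 12 * K₁ * √H * K₂ := by gcongr; exact h2 X
    _ = _ := by ring

lemma pairCoeff_zero_left (d : ℕ) : pairCoeff 0 d = 0 := by
  simp [pairCoeff]

lemma pairCoeff_zero_right (n : ℕ) : pairCoeff n 0 = 0 := by
  simp [pairCoeff]

lemma groupedCoeff_zero : groupedCoeff 0 = 0 := by
  simp [groupedCoeff]

lemma hasSum_sum_divisorsAntidiagonal {f : ℕ × ℕ → ℝ} (hf : Summable f)
    (h0 : ∀ n d, n * d = 0 → f (n, d) = 0) :
    HasSum (fun e : ℕ => ∑ p ∈ e.divisorsAntidiagonal, f p) (∑' p, f p) := by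
  have h := hf.hasSum.tsum_fiberwise (fun p : ℕ × ℕ => p.1 * p.2)
  convert h using 1
  · rfl
  funext e
  rcases eq_or_ne e 0 with rfl | he
  · rw [Nat.divisorsAntidiagonal_zero, sum_empty]
    symm
    convert tsum_zero with x
    exact h0 _ _ x.2
  · have : (fun p : ℕ × ℕ => p.1 * p.2) ⁻¹' {e} = ↑(e.divisorsAntidiagonal) := by
      ext p
      simp [he]
    rw [this, Finset.tsum_subtype']

lemma cbrtWeight_one_div {q : ℝ} (hq : 1 ≤ q) : cbrtWeight (1 / q) = (1 / q) ^ (2 / 3 : ℝ) := by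
  have hq0 : 0 < q := by linarith
  have h1 : (1 / q) ^ (1 / 3 : ℝ) ≤ 1 :=
    Real.rpow_le_one (by positivity) (by rw [div_le_one hq0]; exact hq) (by norm_num)
  have h0 : 0 ≤ (1 / q) ^ (1 / 3 : ℝ) := by positivity
  rw [cbrtWeight, min_eq_right (by nlinarith), ← Real.rpow_natCast, ← Real.rpow_mul (by positivity)]
  norm_num

lemma one_div_le_cbrtWeight {q : ℝ} (hq : 1 ≤ q) : 1 / q ≤ cbrtWeight (1 / q) := by
  have hq0 : 0 < q := by linarith
  rw [cbrtWeight_one_div hq]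
  conv_lhs => rw [← Real.rpow_one (1 / q)]
  exact Real.rpow_le_rpow_of_exponent_ge (by positivity) (by rw [div_le_one hq0]; exact hq)
    (by norm_num)

lemma log_div_le_cbrtWeight {q : ℝ} (hq : 1 ≤ q) : Real.log q / q ≤ 3 * cbrtWeight (1 / q) := by
  have hq0 : 0 < q := by linarith
  rw [cbrtWeight_one_div hq]
  have h := Real.log_le_rpow_div hq0.le (ε := 1 / 3) (by norm_num)
  have e : (1 / q) ^ (2 / 3 : ℝ) = q ^ (1 / 3 : ℝ) / q := by
    rw [one_div, Real.inv_rpow hq0.le, ← Real.rpow_neg hq0.le, eq_div_iff hq0.ne']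
    conv_lhs => rw [← Real.rpow_one q, ← Real.rpow_mul hq0.le, ← Real.rpow_add hq0]
    norm_num
  rw [e, ← mul_div_assoc]
  gcongr
  linarith

lemma summable_abs_pairCoeff_mul_cbrtWeight :
    Summable fun p : ℕ × ℕ => |pairCoeff p.1 p.2| * cbrtWeight (1 / (p.1 * p.2)) := by
  obtain ⟨K, -, h⟩ := sum_abs_pairCoeff_mul_cbrtWeight_le
  have hnn : ∀ p : ℕ × ℕ, 0 ≤ |pairCoeff p.1 p.2| * cbrtWeight (1 / (p.1 * p.2)) :=
    fun p => mul_nonneg (abs_nonneg _) (cbrtWeight_nonneg (by positivity))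
  refine summable_of_sum_le (c := K) hnn fun u => ?_
  obtain ⟨X, hX⟩ : ∃ X : ℕ, ∀ p ∈ u, p.1 ≤ X ∧ p.2 ≤ X :=
    ⟨u.sup fun p => max p.1 p.2, fun p hp => by
      have := Finset.le_sup (f := fun p : ℕ × ℕ => max p.1 p.2) hp
      exact ⟨(le_max_left _ _).trans this, (le_max_right _ _).trans this⟩⟩
  have h' := h 1 X one_pos
  rw [Real.sqrt_one, mul_one] at h'
  refine le_trans ?_ h'
  rw [← sum_product' (Icc 1 X) (Icc 1 X)
    (fun n d : ℕ => |pairCoeff n d| * cbrtWeight (1 / (n * d)))]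
  rw [← sum_filter_of_ne (p := fun p : ℕ × ℕ => p.1 ≠ 0 ∧ p.2 ≠ 0)]
  · refine sum_le_sum_of_subset_of_nonneg ?_ fun p _ _ => hnn p
    intro p hp
    simp only [mem_filter, mem_product, mem_Icc] at hp ⊢
    have := hX p hp.1
    omega
  · rintro ⟨n, d⟩ _ hne
    constructor
    · rintro rfl; simp [pairCoeff_zero_left] at hne
    · rintro rfl; simp [pairCoeff_zero_right] at hne

lemma summable_pairCoeff_mul {g : ℕ → ℝ} {c : ℝ}
    (hg : ∀ q : ℕ, 1 ≤ q → |g q| ≤ c * cbrtWeight (1 / q)) :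
    Summable fun p : ℕ × ℕ => pairCoeff p.1 p.2 * g (p.1 * p.2) := by
  refine Summable.of_norm_bounded (summable_abs_pairCoeff_mul_cbrtWeight.mul_left c) ?_
  rintro ⟨n, d⟩
  rcases eq_or_ne (n * d) 0 with h | h
  · rcases mul_eq_zero.1 h with rfl | rfl
    · simp [pairCoeff_zero_left]
    · simp [pairCoeff_zero_right]
  · have := hg (n * d) (Nat.one_le_iff_ne_zero.2 h)
    push_cast at this
    rw [Real.norm_eq_abs, abs_mul]
    calc _ ≤ |pairCoeff n d| * (c * cbrtWeight (1 / (n * d))) := by gcongr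
      _ = _ := by ring

lemma hasSum_groupedCoeff_mul {g : ℕ → ℝ} {c : ℝ}
    (hg : ∀ q : ℕ, 1 ≤ q → |g q| ≤ c * cbrtWeight (1 / q)) :
    HasSum (fun e => groupedCoeff e * g e) (∑' n, ∑' d, pairCoeff n d * g (n * d)) := by
  have hs := summable_pairCoeff_mul hg
  have h := hasSum_sum_divisorsAntidiagonal hs (fun n d h => by
    rcases mul_eq_zero.1 h with rfl | rfl
    · simp [pairCoeff_zero_left]
    · simp [pairCoeff_zero_right])
  rw [hs.tsum_prod] at h
  convert h using 1
  funext e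
  rw [groupedCoeff, sum_mul]
  refine sum_congr rfl fun p hp => ?_
  rw [(Nat.mem_divisorsAntidiagonal.1 hp).1]

lemma tsum_pairCoeff_mul (n : ℕ) (g : ℕ → ℝ) :
    ∑' d, pairCoeff n d * g d
      = sqfreeInvTotient n * ∑ d ∈ n.divisors, ArithmeticFunction.moebius d * (d * g d) := by
  rcases eq_or_ne n 0 with rfl | hn
  · simp [pairCoeff_zero_left]
  rw [tsum_eq_sum (s := n.divisors), mul_sum]
  · refine sum_congr rfl fun d hd => ?_
    rw [pairCoeff, if_pos (Nat.dvd_of_mem_divisors hd)]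
    ring
  · intro d hd
    rw [pairCoeff, if_neg (fun h => hd (Nat.mem_divisors.2 ⟨h, hn⟩)), zero_mul]

lemma sum_divisors_moebius (n : ℕ) :
    ∑ d ∈ n.divisors, (ArithmeticFunction.moebius d : ℝ) = if n = 1 then 1 else 0 := by
  have h : ∑ d ∈ n.divisors, ArithmeticFunction.moebius d = if n = 1 then 1 else 0 := by
    rw [← ArithmeticFunction.coe_mul_zeta_apply, ArithmeticFunction.moebius_mul_coe_zeta,
      ArithmeticFunction.one_apply]
  exact_mod_cast congrArg (fun z : ℤ => (z : ℝ)) h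

lemma hasSum_groupedCoeff_div : HasSum (fun e : ℕ => groupedCoeff e * (1 / (e : ℝ))) 1 := by
  have h := hasSum_groupedCoeff_mul (g := fun e : ℕ => 1 / (e : ℝ)) (c := 1) (fun q hq => by
    have hq' : (1 : ℝ) ≤ q := by exact_mod_cast hq
    rw [abs_of_nonneg (by positivity), one_mul]
    exact one_div_le_cbrtWeight hq')
  convert h
  symm
  rw [tsum_eq_single 1]
  · rw [tsum_pairCoeff_mul 1 (fun d => 1 / ((1 * d : ℕ) : ℝ))]
    simp [sqfreeInvTotient_apply]
  · intro n hn
    rw [tsum_pairCoeff_mul n (fun d => 1 / ((n * d : ℕ) : ℝ))]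
    have : ∀ d ∈ n.divisors, (ArithmeticFunction.moebius d : ℝ) * (d * (1 / ((n * d : ℕ) : ℝ)))
        = ArithmeticFunction.moebius d * (1 / n) := by
      intro d hd
      have : (d : ℝ) ≠ 0 := by exact_mod_cast (Nat.pos_of_mem_divisors hd).ne'
      push_cast
      field_simp
    rw [sum_congr rfl this, ← sum_mul, sum_divisors_moebius, if_neg hn]
    simp

lemma hasSum_groupedCoeff_mul_log_div :
    HasSum (fun e : ℕ => groupedCoeff e * (Real.log e / e))
      (-∑' p : Nat.Primes, Real.log p / ((p : ℝ) * ((p : ℝ) - 1))) := by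
  have h := hasSum_groupedCoeff_mul (g := fun e : ℕ => Real.log e / e) (c := 3) (fun q hq => by
    have hq' : (1 : ℝ) ≤ q := by exact_mod_cast hq
    rw [abs_of_nonneg (div_nonneg (Real.log_nonneg hq') (by positivity))]
    exact log_div_le_cbrtWeight hq')
  convert h
  have key : ∀ n : ℕ, ∑' d, pairCoeff n d * (Real.log (n * d : ℕ) / (n * d : ℕ))
      = -({p : ℕ | p.Prime}.indicator
        (fun p : ℕ => Real.log p / ((p : ℝ) * ((p : ℝ) - 1))) n) := by
    intro n
    rw [tsum_pairCoeff_mul n (fun d => Real.log (n * d : ℕ) / ((n * d : ℕ) : ℝ))]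
    rcases eq_or_ne n 0 with rfl | hn
    · simp [Set.indicator]
    have hn' : (n : ℝ) ≠ 0 := by exact_mod_cast hn
    have h1 : ∀ d ∈ n.divisors,
        (ArithmeticFunction.moebius d : ℝ) * (d * (Real.log (n * d : ℕ) / ((n * d : ℕ) : ℝ)))
        = ArithmeticFunction.moebius d * (Real.log n / n)
          + (ArithmeticFunction.moebius d * Real.log d) * (1 / n) := by
      intro d hd
      have : (d : ℝ) ≠ 0 := by exact_mod_cast (Nat.pos_of_mem_divisors hd).ne'
      push_cast
      rw [Real.log_mul hn' this]
      field_simp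
    have h2 := ArithmeticFunction.sum_moebius_mul_log_eq (n := n)
    simp only [ArithmeticFunction.log_apply] at h2
    rw [sum_congr rfl h1, sum_add_distrib, ← sum_mul, ← sum_mul, h2, sum_divisors_moebius]
    have h3 : (if n = 1 then (1 : ℝ) else 0) * (Real.log n / n) = 0 := by
      split_ifs with h
      · simp [h]
      · simp
    rw [h3, zero_add]
    by_cases hp : n.Prime
    · rw [Set.indicator_of_mem (show n ∈ {p : ℕ | p.Prime} from hp), sqfreeInvTotient_prime hp,
        ArithmeticFunction.vonMangoldt_apply_prime hp]
      have : (1 : ℝ) < n := by exact_mod_cast hp.one_lt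
      have : (n : ℝ) - 1 ≠ 0 := by linarith
      field_simp
    · rw [Set.indicator_of_notMem (show n ∉ {p : ℕ | p.Prime} from hp)]
      by_cases hs : Squarefree n
      · rw [ArithmeticFunction.vonMangoldt_eq_zero_iff.2
          fun h => hp (Nat.squarefree_and_prime_pow_iff_prime.1 ⟨hs, h⟩)]
        simp
      · rw [sqfreeInvTotient_of_not_squarefree hs]; simp
  simp only [key]
  rw [tsum_neg, ← _root_.tsum_subtype]
  rfl

lemma summable_groupedCoeff_div_sq : Summable fun e : ℕ => groupedCoeff e * (1 / (e : ℝ) ^ 2) :=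
  (hasSum_groupedCoeff_mul (g := fun e : ℕ => 1 / (e : ℝ) ^ 2) (c := 1) (fun q hq => by
    have hq' : (1 : ℝ) ≤ q := by exact_mod_cast hq
    rw [abs_of_nonneg (by positivity), one_mul]
    refine le_trans ?_ (one_div_le_cbrtWeight hq')
    apply one_div_le_one_div_of_le (by positivity)
    nlinarith)).summable

lemma summable_groupedCoeff_mul_log_div_sq :
    Summable fun e : ℕ => groupedCoeff e * (Real.log e / (e : ℝ) ^ 2) :=
  (hasSum_groupedCoeff_mul (g := fun e : ℕ => Real.log e / (e : ℝ) ^ 2) (c := 3) (fun q hq => by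
    have hq' : (1 : ℝ) ≤ q := by exact_mod_cast hq
    have hl := Real.log_nonneg hq'
    rw [abs_of_nonneg (by positivity)]
    refine le_trans ?_ (log_div_le_cbrtWeight hq')
    apply div_le_div_of_nonneg_left hl (by positivity)
    nlinarith)).summable

lemma zetaTwo_mul_tsum_groupedCoeff_div_sq :
    zetaTwo * ∑' e : ℕ, groupedCoeff e * (1 / (e : ℝ) ^ 2) = frakc := by
  have hz : Summable fun n : ℕ => 1 / (n : ℝ) ^ 2 :=
    Real.summable_one_div_nat_pow.2 (by norm_num)
  have hg := summable_groupedCoeff_div_sq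
  have hp := summable_mul_of_summable_norm hz.norm hg.norm
  rw [zetaTwo, tsum_mul_tsum_of_summable_norm hz.norm hg.norm]
  have h := hasSum_sum_divisorsAntidiagonal hp (fun n d h => by
    rcases mul_eq_zero.1 h with rfl | rfl
    · simp
    · simp)
  rw [← h.tsum_eq, frakc]
  refine tsum_congr fun k => ?_
  rcases eq_or_ne k 0 with rfl | hk
  · simp
  have e : ∀ p ∈ k.divisorsAntidiagonal,
      1 / (p.1 : ℝ) ^ 2 * (groupedCoeff p.2 * (1 / (p.2 : ℝ) ^ 2))
        = 1 / (k : ℝ) ^ 2 * groupedCoeff p.2 := by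
    intro p hp
    rw [← (Nat.mem_divisorsAntidiagonal.1 hp).1]
    push_cast
    rw [mul_pow, one_div, one_div, one_div, mul_inv]
    ring
  have hk' : (k : ℝ) ≠ 0 := by exact_mod_cast hk
  rw [sum_congr rfl e, ← mul_sum, Nat.sum_divisorsAntidiagonal' (fun _ v => groupedCoeff v),
    sum_divisors_groupedCoeff hk, sqfreeInvTotient_apply]
  field_simp

lemma two_mul_GammaMinusOne : 2 * GammaMinusOne = Real.eulerMascheroniConstant
    + (∑' p : Nat.Primes, Real.log p / ((p : ℝ) * ((p : ℝ) - 1))) + Real.log (2 * Real.pi) := by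
  have h : Complex.log (2 * Real.pi) = (Real.log (2 * Real.pi) : ℂ) := by
    rw [Complex.ofReal_log (by positivity)]; push_cast; rfl
  rw [GammaMinusOne, riemannZeta_zero, deriv_riemannZeta_zero, h]
  generalize (∑' p : Nat.Primes, Real.log p / ((p : ℝ) * ((p : ℝ) - 1))) = P
  generalize Real.log (2 * Real.pi) = L
  have : (-1 / 2 * (-(Real.eulerMascheroniConstant : ℂ) - (P : ℂ)) - -(L : ℂ) / 2)
      = (((Real.eulerMascheroniConstant + P + L) / 2 : ℝ) : ℂ) := by
    push_cast; ring
  rw [this, Complex.ofReal_re]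
  ring

lemma sum_abs_groupedCoeff_mul_cbrtWeight_le :
    ∃ K : ℝ, 0 < K ∧ ∀ (H : ℝ) (X : ℕ), 0 < H →
      ∑ e ∈ Icc 1 X, |groupedCoeff e| * cbrtWeight (H / e) ≤ K * √H := by
  obtain ⟨K, hK, h⟩ := sum_abs_pairCoeff_mul_cbrtWeight_le
  refine ⟨K, hK, fun H X hH => le_trans ?_ (h H X hH)⟩
  have hnn : ∀ n d : ℕ, 0 ≤ |pairCoeff n d| * cbrtWeight (H / (n * d)) :=
    fun n d => mul_nonneg (abs_nonneg _) (cbrtWeight_nonneg (by positivity))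
  calc _ ≤ ∑ e ∈ Icc 1 X, ∑ p ∈ e.divisorsAntidiagonal,
        |pairCoeff p.1 p.2| * cbrtWeight (H / (p.1 * p.2)) := by
        refine sum_le_sum fun e _ => ?_
        have e1 : ∀ p ∈ e.divisorsAntidiagonal,
            |pairCoeff p.1 p.2| * cbrtWeight (H / (p.1 * p.2))
              = |pairCoeff p.1 p.2| * cbrtWeight (H / e) := by
          intro p hp
          rw [← (Nat.mem_divisorsAntidiagonal.1 hp).1]
          push_cast; rfl
        rw [sum_congr rfl e1, ← sum_mul, groupedCoeff]
        exact mul_le_mul_of_nonneg_right (abs_sum_le_sum_abs _ _)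
          (cbrtWeight_nonneg (by positivity))
    _ = ∑ n ∈ Icc 1 X, ∑ d ∈ Icc 1 (X / n), |pairCoeff n d| * cbrtWeight (H / (n * d)) :=
        sum_Icc_divisorsAntidiagonal X
          (fun n d => |pairCoeff n d| * cbrtWeight (H / (n * d)))
    _ ≤ _ := sum_le_sum fun n _ => sum_le_sum_of_subset_of_nonneg
        (Icc_subset_Icc le_rfl (Nat.div_le_self _ _)) fun d _ _ => hnn n d

lemma hasSum_groupedCoeff_mul_divisorMeanMain {H : ℝ} (hH : 0 < H) :
    HasSum (fun e : ℕ => groupedCoeff e * divisorMeanMain (H / e))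
      (frakc * H ^ 2 * Real.log H
        + (((Real.eulerMascheroniConstant - 3 / 2) * zetaTwo - logZetaTwo)
            * (∑' e : ℕ, groupedCoeff e * (1 / (e : ℝ) ^ 2))
          - zetaTwo * ∑' e : ℕ, groupedCoeff e * (Real.log e / (e : ℝ) ^ 2)) * H ^ 2
        + H * Real.log H + 2 * GammaMinusOne * H) := by
  have h1 := hasSum_groupedCoeff_div
  have h2 := hasSum_groupedCoeff_mul_log_div
  have h3 := summable_groupedCoeff_div_sq.hasSum
  have h4 := summable_groupedCoeff_mul_log_div_sq.hasSum
  rw [two_mul_GammaMinusOne, ← zetaTwo_mul_tsum_groupedCoeff_div_sq]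
  convert (((h3.mul_left (zetaTwo * H ^ 2 * Real.log H
      + ((Real.eulerMascheroniConstant - 3 / 2) * zetaTwo - logZetaTwo) * H ^ 2)).sub
    (h4.mul_left (zetaTwo * H ^ 2))).add
    (h1.mul_left (H * Real.log H + (Real.eulerMascheroniConstant + Real.log (2 * Real.pi)) * H))).sub
    (h2.mul_left H) using 1
  · rfl
  · funext e
    rcases eq_or_ne e 0 with rfl | he
    · simp [groupedCoeff_zero]
    have he' : (e : ℝ) ≠ 0 := by exact_mod_cast he
    rw [divisorMeanMain, Real.log_div hH.ne' he']
    field_simp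
    ring
  · ring

lemma abs_divisorMean_sub_le : ∃ C : ℝ, 0 < C ∧ ∀ x : ℝ, 0 < x →
    |divisorMean x - divisorMeanMain x| ≤ C * cbrtWeight x := by
  obtain ⟨C, hC, h⟩ := divisorMean_expansion
  refine ⟨C, hC, fun x hx => ?_⟩
  have h3 : (x ^ (1 / 3 : ℝ)) ^ 3 = x := by
    rw [← Real.rpow_natCast, ← Real.rpow_mul hx.le]; norm_num
  have := h (x ^ (1 / 3 : ℝ)) (by positivity)
  rwa [h3] at this

end AuxiliaryLemmas

theorem statement13 :
    ∃ Γ₀ : ℝ, ∃ κ > (0:ℝ), ∀ H : ℝ, 2 ≤ H →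
      |(∑ h ∈ Finset.Icc 1 ⌊H⌋₊, (H - (h : ℝ)) ^ 2 / (Nat.totient h : ℝ))
          - (frakc * H ^ 2 * Real.log H + 2 * Γ₀ * H ^ 2 + H * Real.log H
              + 2 * GammaMinusOne * H)|
        ≤ κ * H ^ ((1:ℝ)/2) := by
  obtain ⟨K, hK, hsum⟩ := sum_abs_groupedCoeff_mul_cbrtWeight_le
  obtain ⟨C, hC, hrem⟩ := abs_divisorMean_sub_le
  refine ⟨(((Real.eulerMascheroniConstant - 3 / 2) * zetaTwo - logZetaTwo)
      * (∑' e : ℕ, groupedCoeff e * (1 / (e : ℝ) ^ 2))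
    - zetaTwo * ∑' e : ℕ, groupedCoeff e * (Real.log e / (e : ℝ) ^ 2)) / 2, C * K,
    by positivity, fun H hH => ?_⟩
  have hH0 : 0 < H := by linarith
  rw [mul_div_cancel₀ _ (two_ne_zero' ℝ), ← Real.sqrt_eq_rpow, sum_sq_div_totient_eq]
  have hmain := (hasSum_groupedCoeff_mul_divisorMeanMain hH0).tendsto_sum_nat.comp
    (Filter.tendsto_add_atTop_nat 1)
  refine le_of_tendsto (tendsto_const_nhds.sub hmain).abs ?_
  filter_upwards [Filter.eventually_ge_atTop ⌊H⌋₊] with X hX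
  have e1 : ∑ e ∈ Finset.Icc 1 ⌊H⌋₊, groupedCoeff e * divisorMean (H / e)
      = ∑ e ∈ Finset.Icc 1 X, groupedCoeff e * divisorMean (H / e) := by
    refine Finset.sum_subset (Finset.Icc_subset_Icc le_rfl hX) fun e he he' => ?_
    rw [Finset.mem_Icc] at he he'
    have he0 : (0 : ℝ) < e := by exact_mod_cast he.1
    rw [divisorMean_eq_zero, mul_zero]
    rw [div_lt_one he0]
    exact Nat.lt_of_floor_lt (by omega)
  have e2 : ∑ e ∈ Finset.range (X + 1), groupedCoeff e * divisorMeanMain (H / e)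
      = ∑ e ∈ Finset.Icc 1 X, groupedCoeff e * divisorMeanMain (H / e) := by
    rw [Finset.range_eq_Ico, Finset.sum_eq_sum_Ico_succ_bot (by omega), groupedCoeff_zero,
      zero_mul, zero_add]
    rfl
  rw [Function.comp_apply, e1, e2, ← Finset.sum_sub_distrib]
  calc _ ≤ ∑ e ∈ Finset.Icc 1 X, C * (|groupedCoeff e| * cbrtWeight (H / e)) := by
        refine (Finset.abs_sum_le_sum_abs _ _).trans (Finset.sum_le_sum fun e he => ?_)
        have he0 : (0 : ℝ) < e := by exact_mod_cast (Finset.mem_Icc.1 he).1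
        rw [← mul_sub, abs_mul, mul_left_comm]
        gcongr
        exact hrem _ (by positivity)
    _ ≤ C * (K * √H) := by
        rw [← Finset.mul_sum]
        gcongr
        exact hsum H X hH0
    _ = _ := by ring
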